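/- arXiv:1110.1785 — 3 statements merged into one kernel-verified Lean document; each statement's English description precedes it below -/
import Mathlib

section
/- Let η ∈ (0,1) and set m = ⌈108·M·(n−1)·ε^{−1}·ln(4/η)⌉ (note m ≤ ⌈216·n·(n−1)²·ε^{−2}·ln(4/η)⌉). Then for every urn i ∈ {1,…,n}: if m voters independently each cast a vote equal to urn j with probability E_i(j), the probability that urn i receives strictly more votes than every other urn is at least 1 − η. -/
open Finset in
lemma aux_mgf (a q Δ x : ℝ) (hq : 0 ≤ q) (hΔ : 0 < Δ) (hqa : q = a - Δ)
    (hx : x = 1 - Δ / (2 * a)) :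
    0 < x ∧ x ≤ 1 ∧ a * x + q * x⁻¹ + (1 - a - q) ≤ 1 - Δ ^ 2 / (4 * a) := by
  have ha : 0 < a := by linarith
  have hδ : Δ / a ≤ 1 := by rw [div_le_one ha]; linarith
  have hδ0 : 0 < Δ / a := by positivity
  obtain ⟨δ, hδe⟩ : ∃ δ, δ = Δ / a := ⟨_, rfl⟩
  have hΔe : Δ = δ * a := by rw [hδe]; field_simp
  rw [← hδe] at hδ hδ0
  have hx' : x = 1 - δ / 2 := by rw [hx, hΔe]; field_simp
  have hxp : 0 < x := by rw [hx']; linarith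
  refine ⟨hxp, by rw [hx']; linarith, ?_⟩
  have h1 : Δ ^ 2 / (4 * a) = a * δ ^ 2 / 4 := by rw [hΔe]; field_simp
  have h2 : q * x⁻¹ ≤ a * x - a * δ ^ 2 / 4 + (a * δ ^ 2 / 4) - (a * x) + (a + q - a * x - a * δ^2/4) := by
    rw [← div_eq_mul_inv, div_le_iff₀ hxp, hqa, hΔe, hx']
    have : 0 ≤ a * δ ^ 3 := by positivity
    nlinarith
  rw [h1]; linarith

open Classical in
lemma aux_tail (m : ℕ) (S : Finset ℕ) (e : ℕ → ℝ) (he : ∀ k ∈ S, 0 ≤ e k)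
    (hs : ∑ k ∈ S, e k = 1) (i j : ℕ) (hi : i ∈ S) (hj : j ∈ S) (hij : j ≠ i)
    (D : ℝ) (hD : 0 < D) (hgap : e j + D ≤ e i) :
    ∑ v ∈ Fintype.piFinset (fun _ : Fin m => S),
      (if (Finset.univ.filter (fun t : Fin m => v t = i)).card ≤
          (Finset.univ.filter (fun t : Fin m => v t = j)).card
        then ∏ t : Fin m, e (v t) else 0) ≤ Real.exp (-(m * (D ^ 2 / (4 * e i)))) := by
  obtain ⟨x, hx⟩ : ∃ x, x = 1 - (e i - e j) / (2 * e i) := ⟨_, rfl⟩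
  obtain ⟨hx0, hx1, hmgf⟩ := aux_mgf (e i) (e j) (e i - e j) x (he j hj) (by linarith) (by ring) hx
  have hei : 0 < e i := by linarith [he j hj]
  have hf0 : ∀ k, (0:ℝ) ≤ (if k = i then x else if k = j then x⁻¹ else 1) := by
    intro k; split_ifs <;> positivity
  have hprod : ∀ v : Fin m → ℕ, ∏ t : Fin m, (if v t = i then x else if v t = j then x⁻¹ else 1)
      = x ^ (Finset.univ.filter (fun t : Fin m => v t = i)).card *
        x⁻¹ ^ (Finset.univ.filter (fun t : Fin m => v t = j)).card := by
    intro v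
    have : ∀ t, (if v t = i then x else if v t = j then x⁻¹ else 1)
      = (if v t = i then x else 1) * (if v t = j then x⁻¹ else 1) := by
      intro t
      by_cases h1 : v t = i
      · have : v t ≠ j := by rw [h1]; exact hij.symm
        rw [if_pos h1, if_pos h1, if_neg this, mul_one]
      · rw [if_neg h1, if_neg h1, one_mul]
    rw [Finset.prod_congr rfl (fun t _ => this t), Finset.prod_mul_distrib]
    simp [Finset.prod_ite]
  have step : ∑ v ∈ Fintype.piFinset (fun _ : Fin m => S),
      (if (Finset.univ.filter (fun t : Fin m => v t = i)).card ≤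
          (Finset.univ.filter (fun t : Fin m => v t = j)).card
        then ∏ t : Fin m, e (v t) else 0) ≤
      ∑ v ∈ Fintype.piFinset (fun _ : Fin m => S),
        ∏ t : Fin m, e (v t) * (if v t = i then x else if v t = j then x⁻¹ else 1) := by
    apply Finset.sum_le_sum
    intro v hv
    rw [Fintype.mem_piFinset] at hv
    rw [Finset.prod_mul_distrib]
    have hp : 0 ≤ ∏ t : Fin m, e (v t) := Finset.prod_nonneg (fun t _ => he _ (hv t))
    split_ifs with h
    · apply le_mul_of_one_le_right hp
      rw [hprod, inv_pow, ← div_eq_mul_inv, one_le_div (by positivity)]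
      exact pow_le_pow_of_le_one hx0.le hx1 h
    · exact mul_nonneg hp (Finset.prod_nonneg (fun t _ => hf0 _))
  have hsum : ∑ k ∈ S, e k * (if k = i then x else if k = j then x⁻¹ else 1)
      = e i * x + e j * x⁻¹ + (1 - e i - e j) := by
    have : ∀ k, e k * (if k = i then x else if k = j then x⁻¹ else 1)
      = e k + (if k = i then e k * (x - 1) else 0) + (if k = j then e k * (x⁻¹ - 1) else 0) := by
      intro k
      by_cases h1 : k = i
      · have : k ≠ j := by rw [h1]; exact hij.symm
        simp only [if_pos h1, if_neg this]; ring
      · by_cases h2 : k = j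
        · simp only [if_neg h1, if_pos h2]; ring
        · simp only [if_neg h1, if_neg h2]; ring
    rw [Finset.sum_congr rfl (fun k _ => this k), Finset.sum_add_distrib, Finset.sum_add_distrib,
      hs, Finset.sum_ite_eq', Finset.sum_ite_eq', if_pos hi, if_pos hj]
    ring
  refine step.trans ?_
  rw [← Finset.prod_univ_sum (fun _ : Fin m => S)
    (fun _ k => e k * (if k = i then x else if k = j then x⁻¹ else 1))]
  rw [Finset.prod_const, hsum, Finset.card_univ, Fintype.card_fin]
  have hnn : 0 ≤ e i * x + e j * x⁻¹ + (1 - e i - e j) := by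
    rw [← hsum]
    exact Finset.sum_nonneg (fun k hk => mul_nonneg (he k hk) (hf0 k))
  have hle : e i * x + e j * x⁻¹ + (1 - e i - e j) ≤ Real.exp (-(D ^ 2 / (4 * e i))) := by
    refine hmgf.trans ?_
    have h1 : D ^ 2 / (4 * e i) ≤ (e i - e j) ^ 2 / (4 * e i) := by
      apply div_le_div_of_nonneg_right _ (by positivity)
      apply pow_le_pow_left₀ hD.le; linarith
    have := Real.add_one_le_exp (-(D ^ 2 / (4 * e i)))
    linarith
  refine (pow_le_pow_left₀ hnn hle m).trans ?_
  rw [← Real.exp_nat_mul]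
  apply le_of_eq; congr 1; ring

lemma aux_geom (y : ℝ) (hy0 : 0 ≤ y) (hy : y ≤ 1 / 4) (N : ℕ) :
    ∑ d ∈ Finset.Ico 1 N, y ^ d ≤ 2 * y := by
  rw [Finset.sum_Ico_eq_sum_range]
  have h2 : ∑ k ∈ Finset.range (N - 1), y ^ k ≤ 2 := by
    have h3 := mul_neg_geom_sum y (N - 1)
    have h4 : 0 ≤ y ^ (N - 1) := pow_nonneg hy0 _
    have h5 : 0 ≤ ∑ k ∈ Finset.range (N - 1), y ^ k :=
      Finset.sum_nonneg (fun k _ => pow_nonneg hy0 k)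
    nlinarith
  have : ∀ k, y ^ (1 + k) = y * y ^ k := fun k => by rw [pow_add, pow_one]
  simp only [this]
  rw [← Finset.mul_sum]
  nlinarith

lemma aux_sum (y : ℝ) (hy0 : 0 ≤ y) (hy : y ≤ 1 / 4) (n i : ℕ) (hi : i ∈ Finset.Icc 1 n) :
    ∑ j ∈ (Finset.Icc 1 n).erase i, y ^ (max (j - i) (i - j)) ≤ 4 * y := by
  rw [Finset.mem_Icc] at hi
  have hsub : (Finset.Icc 1 n).erase i = Finset.Ico 1 i ∪ Finset.Ico (i + 1) (n + 1) := by
    ext j; simp only [Finset.mem_erase, Finset.mem_Icc, Finset.mem_union, Finset.mem_Ico]; omega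
  have hdis : Disjoint (Finset.Ico 1 i) (Finset.Ico (i + 1) (n + 1)) := by
    rw [Finset.disjoint_left]; intro j; simp only [Finset.mem_Ico]; omega
  rw [hsub, Finset.sum_union hdis]
  have h1 : ∑ j ∈ Finset.Ico 1 i, y ^ (max (j - i) (i - j)) = ∑ d ∈ Finset.Ico 1 i, y ^ d := by
    apply Finset.sum_bij' (fun j _ => i - j) (fun d _ => i - d)
    all_goals simp only [Finset.mem_Ico]
    · intro a ha; omega
    · intro a ha; omega
    · intro a ha; omega
    · intro a ha; omega
    · intro a ha; congr 1; omega
  have h2 : ∑ j ∈ Finset.Ico (i + 1) (n + 1), y ^ (max (j - i) (i - j))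
      = ∑ d ∈ Finset.Ico 1 (n + 1 - i), y ^ d := by
    apply Finset.sum_bij' (fun j _ => j - i) (fun d _ => d + i)
    all_goals simp only [Finset.mem_Ico]
    · intro a ha; omega
    · intro a ha; omega
    · intro a ha; omega
    · intro a ha; omega
    · intro a ha; congr 1; omega
  rw [h1, h2]
  linarith [aux_geom y hy0 hy i, aux_geom y hy0 hy (n + 1 - i)]

open Classical in
lemma aux_main (m n : ℕ) (e : ℕ → ℝ) (he : ∀ k ∈ Finset.Icc 1 n, 0 ≤ e k)
    (hs : ∑ k ∈ Finset.Icc 1 n, e k = 1) (i : ℕ) (hi : i ∈ Finset.Icc 1 n)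
    (M η : ℝ) (hM : 0 < M) (hη0 : 0 < η) (hη1 : η < 1)
    (hgap : ∀ j ∈ Finset.Icc 1 n, e j + ((max (j - i) (i - j) : ℕ) : ℝ) / M ≤ e i)
    (hm : Real.log (4 / η) * (4 * e i) * M ^ 2 ≤ m) :
      1 - η ≤ ∑ v ∈ Fintype.piFinset (fun _ : Fin m => Finset.Icc 1 n),
        (if ∀ j ∈ Finset.Icc 1 n, j ≠ i →
              (Finset.univ.filter (fun t : Fin m => v t = j)).card <
              (Finset.univ.filter (fun t : Fin m => v t = i)).card
         then ∏ t : Fin m, e (v t) else 0) := by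
  have htot : ∑ v ∈ Fintype.piFinset (fun _ : Fin m => Finset.Icc 1 n), ∏ t : Fin m, e (v t) = 1 := by
    rw [← Finset.prod_univ_sum (fun _ : Fin m => Finset.Icc 1 n) (fun _ k => e k)]
    simp [hs]
  have hbad : ∑ j ∈ (Finset.Icc 1 n).erase i, ∑ v ∈ Fintype.piFinset (fun _ : Fin m => Finset.Icc 1 n),
      (if (Finset.univ.filter (fun t : Fin m => v t = i)).card ≤
          (Finset.univ.filter (fun t : Fin m => v t = j)).card
        then ∏ t : Fin m, e (v t) else 0) ≤ η := by
    have h1 : ∀ j ∈ (Finset.Icc 1 n).erase i, ∑ v ∈ Fintype.piFinset (fun _ : Fin m => Finset.Icc 1 n),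
      (if (Finset.univ.filter (fun t : Fin m => v t = i)).card ≤
          (Finset.univ.filter (fun t : Fin m => v t = j)).card
        then ∏ t : Fin m, e (v t) else 0) ≤ (η / 4) ^ (max (j - i) (i - j)) := by
      intro j hj
      rw [Finset.mem_erase] at hj
      obtain ⟨hji, hj⟩ := hj
      have hd : 1 ≤ max (j - i) (i - j) := by omega
      have hg := hgap j hj
      generalize max (j - i) (i - j) = d at hd hg
      have hd' : (1:ℝ) ≤ d := by exact_mod_cast hd
      have hDp : 0 < (d:ℝ) / M := by positivity
      refine (aux_tail m _ e he hs i j hi hj hji _ hDp hg).trans ?_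
      have hei : 0 < e i := by linarith [he j hj]
      have hL : 0 < Real.log (4 / η) := Real.log_pos (by rw [lt_div_iff₀ hη0]; linarith)
      have hpow : (η / 4) ^ d = Real.exp (-(d * Real.log (4 / η))) := by
        rw [← mul_neg, ← Real.log_inv, inv_div, Real.exp_nat_mul, Real.exp_log (by positivity)]
      rw [hpow, Real.exp_le_exp, neg_le_neg_iff]
      have h3 : d * Real.log (4 / η) ≤ d ^ 2 * Real.log (4 / η) := by
        apply mul_le_mul_of_nonneg_right _ hL.le
        nlinarith
      refine h3.trans ?_
      have h4 : (d:ℝ) ^ 2 * Real.log (4 / η) =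
        (Real.log (4 / η) * (4 * e i) * M ^ 2) * ((d / M) ^ 2 / (4 * e i)) := by
        field_simp
      rw [h4]
      exact mul_le_mul_of_nonneg_right hm (by positivity)
    refine (Finset.sum_le_sum h1).trans ?_
    have := aux_sum (η / 4) (by positivity) (by linarith) n i hi
    linarith
  rw [Finset.sum_comm] at hbad
  have hkey : ∑ v ∈ Fintype.piFinset (fun _ : Fin m => Finset.Icc 1 n), ∏ t : Fin m, e (v t) ≤
     ∑ v ∈ Fintype.piFinset (fun _ : Fin m => Finset.Icc 1 n),
        (if ∀ j ∈ Finset.Icc 1 n, j ≠ i →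
              (Finset.univ.filter (fun t : Fin m => v t = j)).card <
              (Finset.univ.filter (fun t : Fin m => v t = i)).card
         then ∏ t : Fin m, e (v t) else 0) + 
     ∑ v ∈ Fintype.piFinset (fun _ : Fin m => Finset.Icc 1 n), ∑ j ∈ (Finset.Icc 1 n).erase i,
      (if (Finset.univ.filter (fun t : Fin m => v t = i)).card ≤
          (Finset.univ.filter (fun t : Fin m => v t = j)).card
        then ∏ t : Fin m, e (v t) else 0) := by
    rw [← Finset.sum_add_distrib]
    apply Finset.sum_le_sum
    intro v hv
    rw [Fintype.mem_piFinset] at hv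
    have hp : 0 ≤ ∏ t : Fin m, e (v t) := Finset.prod_nonneg (fun t _ => he _ (hv t))
    have hnn : ∀ j ∈ (Finset.Icc 1 n).erase i, 0 ≤ 
      (if (Finset.univ.filter (fun t : Fin m => v t = i)).card ≤
          (Finset.univ.filter (fun t : Fin m => v t = j)).card
        then ∏ t : Fin m, e (v t) else 0) := by
      intro j _; split_ifs <;> simp [hp]
    split_ifs with h
    · linarith [Finset.sum_nonneg hnn]
    · push Not at h
      obtain ⟨j, hj, hji, hc⟩ := h
      have := Finset.single_le_sum hnn (Finset.mem_erase.2 ⟨hji, hj⟩)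
      rw [if_pos hc] at this
      linarith
  linarith


/- STATEMENT 3: With m = ⌈108·M·(n−1)·ε⁻¹·ln(4/η)⌉ voters, each voting independently
for urn j with probability E_i(j) (correct urn i), the probability that urn i receives
strictly more votes than every other urn is at least 1 − η. -/
open Classical in
theorem stmt_3
    (n : ℕ) (hn : 2 ≤ n)
    (p : ℕ → ℝ)
    (hp0 : 0 ≤ p 1) (hp1 : p n ≤ 1)
    (hmono : ∀ i ∈ Finset.Ico 1 n, p i < p (i + 1))
    (ε : ℝ)
    (hε : IsLeast {x : ℝ | ∃ i, 1 ≤ i ∧ i < n ∧ x = p (i + 1) - p i} ε)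
    (b r : ℕ → ℝ)
    (hb : ∀ k, b k = ∑ ℓ ∈ Finset.Ico 1 k, (2 - (p (ℓ + 1) + p ℓ)) / (p (ℓ + 1) - p ℓ))
    (hr : ∀ k, r k = ∑ ℓ ∈ Finset.Ico k n, (p (ℓ + 1) + p ℓ) / (p (ℓ + 1) - p ℓ))
    (R B M : ℝ)
    (hR : R = ∑ k ∈ Finset.Icc 1 n, r k)
    (hB : B = ∑ k ∈ Finset.Icc 1 n, b k)
    (hM : M = max R B)
    (Rv Bv : ℕ → ℝ)
    (hRv : ∀ j, Rv j = (r j + (M - R) / n) / M)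
    (hBv : ∀ j, Bv j = (b j + (M - B) / n) / M)
    (E : ℕ → ℕ → ℝ)
    (hE : ∀ i j, E i j = p i * Bv j + (1 - p i) * Rv j)
    (η : ℝ) (hη0 : 0 < η) (hη1 : η < 1)
    (m : ℕ) (hm : (m : ℤ) = ⌈108 * M * ((n : ℝ) - 1) * ε⁻¹ * Real.log (4 / η)⌉) :
    ∀ i ∈ Finset.Icc 1 n,
      1 - η ≤ ∑ v ∈ Fintype.piFinset (fun _ : Fin m => Finset.Icc 1 n),
        (if ∀ j ∈ Finset.Icc 1 n, j ≠ i →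
              (Finset.univ.filter (fun t : Fin m => v t = j)).card <
              (Finset.univ.filter (fun t : Fin m => v t = i)).card
         then ∏ t : Fin m, E i (v t) else 0) := by
  intro i hi
  have hi' := Finset.mem_Icc.1 hi
  have hmon : ∀ a c, 1 ≤ a → a ≤ c → c ≤ n → p a ≤ p c := by
    intro a c ha hac
    induction c, hac using Nat.le_induction with
    | base => intro _; exact le_rfl
    | succ c hc ih =>
      intro hcn
      exact (ih (by omega)).trans (hmono c (by rw [Finset.mem_Ico]; omega)).le
  have hp0' : ∀ k, 1 ≤ k → k ≤ n → 0 ≤ p k := fun k h1 h2 => hp0.trans (hmon 1 k le_rfl h1 h2)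
  have hp1' : ∀ k, 1 ≤ k → k ≤ n → p k ≤ 1 := fun k h1 h2 => (hmon k n h1 h2 le_rfl).trans hp1
  have hεle : ∀ k, 1 ≤ k → k < n → ε ≤ p (k + 1) - p k := fun k h1 h2 => hε.2 ⟨k, h1, h2, rfl⟩
  have hdpos : ∀ k, 1 ≤ k → k < n → 0 < p (k + 1) - p k := fun k h1 h2 => by
    linarith [hmono k (Finset.mem_Ico.2 ⟨h1, h2⟩)]
  have hε0 : 0 < ε := by
    obtain ⟨k, h1, h2, h3⟩ := hε.1
    rw [h3]; exact hdpos k h1 h2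
  have hnR : (2:ℝ) ≤ n := by exact_mod_cast hn
  obtain ⟨C, hC⟩ : ∃ C, C = 2 * ((n:ℝ) - 1) / ε := ⟨_, rfl⟩
  have hC0 : 0 < C := by rw [hC]; apply div_pos <;> linarith
  have hcard : ∀ a c, 1 ≤ a → c ≤ n → ((Finset.Ico a c).card : ℝ) * (2 / ε) ≤ C := by
    intro a c ha hc
    have : ((Finset.Ico a c).card : ℝ) ≤ n - 1 := by
      rw [Nat.card_Ico]
      have : c - a + 1 ≤ n := by omega
      have : ((c - a : ℕ) : ℝ) + 1 ≤ n := by exact_mod_cast this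
      linarith
    rw [hC]
    calc _ ≤ ((n:ℝ) - 1) * (2 / ε) := mul_le_mul_of_nonneg_right this (by positivity)
      _ = _ := by ring
  have htb : ∀ k, 1 ≤ k → k < n → 0 ≤ (2 - (p (k + 1) + p k)) / (p (k + 1) - p k) ∧
      (2 - (p (k + 1) + p k)) / (p (k + 1) - p k) ≤ 2 / ε := by
    intro k h1 h2
    have hd := hdpos k h1 h2
    have e1 := hp0' k h1 (by omega)
    have e2 := hp0' (k + 1) (by omega) (by omega)
    have e3 := hp1' k h1 (by omega)
    have e4 := hp1' (k + 1) (by omega) (by omega)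
    exact ⟨div_nonneg (by linarith) hd.le,
      div_le_div₀ (by norm_num) (by linarith) hε0 (hεle k h1 h2)⟩
  have htr : ∀ k, 1 ≤ k → k < n → 0 ≤ (p (k + 1) + p k) / (p (k + 1) - p k) ∧
      (p (k + 1) + p k) / (p (k + 1) - p k) ≤ 2 / ε := by
    intro k h1 h2
    have hd := hdpos k h1 h2
    have e1 := hp0' k h1 (by omega)
    have e2 := hp0' (k + 1) (by omega) (by omega)
    have e3 := hp1' k h1 (by omega)
    have e4 := hp1' (k + 1) (by omega) (by omega)
    exact ⟨div_nonneg (by linarith) hd.le,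
      div_le_div₀ (by norm_num) (by linarith) hε0 (hεle k h1 h2)⟩
  have hb0 : ∀ k, 1 ≤ k → k ≤ n → 0 ≤ b k ∧ b k ≤ C := by
    intro k h1 h2
    rw [hb]
    refine ⟨Finset.sum_nonneg (fun l hl => ?_), le_trans ?_ (hcard 1 k le_rfl h2)⟩
    · rw [Finset.mem_Ico] at hl; exact (htb l hl.1 (by omega)).1
    · rw [← nsmul_eq_mul]
      apply Finset.sum_le_card_nsmul
      intro l hl
      rw [Finset.mem_Ico] at hl; exact (htb l hl.1 (by omega)).2
  have hr0 : ∀ k, 1 ≤ k → k ≤ n → 0 ≤ r k ∧ r k ≤ C := by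
    intro k h1 h2
    rw [hr]
    refine ⟨Finset.sum_nonneg (fun l hl => ?_), le_trans ?_ (hcard k n h1 le_rfl)⟩
    · rw [Finset.mem_Ico] at hl; exact (htr l (by omega) (by omega)).1
    · rw [← nsmul_eq_mul]
      apply Finset.sum_le_card_nsmul
      intro l hl
      rw [Finset.mem_Ico] at hl; exact (htr l (by omega) (by omega)).2
  have hB0 : 0 ≤ B ∧ B ≤ n * C := by
    rw [hB]
    refine ⟨Finset.sum_nonneg (fun l hl => ?_), ?_⟩
    · rw [Finset.mem_Icc] at hl; exact (hb0 l hl.1 hl.2).1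
    · have := Finset.sum_le_card_nsmul (Finset.Icc 1 n) b C
        (fun l hl => (hb0 l (Finset.mem_Icc.1 hl).1 (Finset.mem_Icc.1 hl).2).2)
      simpa using this
  have hR0 : 0 ≤ R ∧ R ≤ n * C := by
    rw [hR]
    refine ⟨Finset.sum_nonneg (fun l hl => ?_), ?_⟩
    · rw [Finset.mem_Icc] at hl; exact (hr0 l hl.1 hl.2).1
    · have := Finset.sum_le_card_nsmul (Finset.Icc 1 n) r C
        (fun l hl => (hr0 l (Finset.mem_Icc.1 hl).1 (Finset.mem_Icc.1 hl).2).2)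
      simpa using this
  have hRpos : 0 < R := by
    have h1 : r 1 ≤ R := by
      rw [hR]
      exact Finset.single_le_sum
        (fun l hl => (hr0 l (Finset.mem_Icc.1 hl).1 (Finset.mem_Icc.1 hl).2).1)
        (Finset.mem_Icc.2 ⟨le_rfl, by omega⟩)
    have h2 : (p (1 + 1) + p 1) / (p (1 + 1) - p 1) ≤ r 1 := by
      rw [hr]
      exact Finset.single_le_sum (f := fun l => (p (l + 1) + p l) / (p (l + 1) - p l))
        (fun l hl => (htr l (Finset.mem_Ico.1 hl).1 (Finset.mem_Ico.1 hl).2).1)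
        (Finset.mem_Ico.2 ⟨le_rfl, by omega⟩)
    have h3 := hdpos 1 le_rfl (by omega)
    have h4 : 0 < (p (1 + 1) + p 1) / (p (1 + 1) - p 1) := div_pos (by linarith) h3
    linarith
  have hRM : R ≤ M := by rw [hM]; exact le_max_left _ _
  have hBM : B ≤ M := by rw [hM]; exact le_max_right _ _
  have hMC : M ≤ n * C := by rw [hM]; exact max_le hR0.2 hB0.2
  have hM0 : 0 < M := by linarith
  have hn0 : (0:ℝ) < n := by linarith
  have hpi0 := hp0' i hi'.1 hi'.2
  have hpi1 := hp1' i hi'.1 hi'.2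
  have hcB : 0 ≤ (M - B) / n ∧ (M - B) / n ≤ C := by
    refine ⟨div_nonneg (by linarith) hn0.le, ?_⟩
    rw [div_le_iff₀ hn0]; linarith [hB0.1]
  have hcR : 0 ≤ (M - R) / n ∧ (M - R) / n ≤ C := by
    refine ⟨div_nonneg (by linarith) hn0.le, ?_⟩
    rw [div_le_iff₀ hn0]; linarith [hR0.1]
  have hstep : ∀ k, 1 ≤ k → k < n →
      E i (k + 1) - E i k = (2 * p i - (p (k + 1) + p k)) / (p (k + 1) - p k) / M := by
    intro k h1 h2
    have hd := hdpos k h1 h2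
    have eb : b (k + 1) = b k + (2 - (p (k + 1) + p k)) / (p (k + 1) - p k) := by
      rw [hb, hb, Finset.sum_Ico_succ_top h1]
    have er : r k = (p (k + 1) + p k) / (p (k + 1) - p k) + r (k + 1) := by
      rw [hr, hr, Finset.sum_eq_sum_Ico_succ_bot h2]
    rw [hE, hE, hBv, hBv, hRv, hRv, eb, er]
    have := hd.ne'
    field_simp
    ring
  have hup : ∀ d : ℕ, i + d ≤ n → E i (i + d) + (d : ℝ) / M ≤ E i i := by
    intro d
    induction d with
    | zero => intro _; simp
    | succ d ih =>
      intro h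
      have h1 := ih (by omega)
      have h2 := hstep (i + d) (by omega) (by omega)
      have hd := hdpos (i + d) (by omega) (by omega)
      have h3 := hmon i (i + d) (by omega) (by omega) (by omega)
      have h4 : (2 * p i - (p (i + d + 1) + p (i + d))) / (p (i + d + 1) - p (i + d)) / M
          ≤ (-1) / M := by
        apply div_le_div_of_nonneg_right _ hM0.le
        rw [div_le_iff₀ hd]; linarith
      rw [← add_assoc]
      push_cast
      rw [add_div]
      rw [neg_div] at h4
      linarith
  have hdn : ∀ d j : ℕ, 1 ≤ j → j + d = i → E i j + (d : ℝ) / M ≤ E i i := by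
    intro d
    induction d with
    | zero => intro j _ h; simp at h; simp [h]
    | succ d ih =>
      intro j hj h
      have h1 := ih (j + 1) (by omega) (by omega)
      have h2 := hstep j (by omega) (by omega)
      have hd := hdpos j (by omega) (by omega)
      have h3 := hmon (j + 1) i (by omega) (by omega) (by omega)
      have h4 : 1 / M ≤ (2 * p i - (p (j + 1) + p j)) / (p (j + 1) - p j) / M := by
        apply div_le_div_of_nonneg_right _ hM0.le
        rw [le_div_iff₀ hd]; linarith
      push_cast
      rw [add_div]
      linarith
  have hL : 0 < Real.log (4 / η) := Real.log_pos (by rw [lt_div_iff₀ hη0]; linarith)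
  apply aux_main m n (E i) ?_ ?_ i hi M η hM0 hη0 hη1 ?_ ?_
  · intro k hk
    rw [Finset.mem_Icc] at hk
    have h1 := (hb0 k hk.1 hk.2).1
    have h2 := (hr0 k hk.1 hk.2).1
    rw [hE, hBv, hRv]
    exact add_nonneg (mul_nonneg hpi0 (div_nonneg (by linarith) hM0.le))
      (mul_nonneg (by linarith) (div_nonneg (by linarith) hM0.le))
  · have e1 : ∑ k ∈ Finset.Icc 1 n, Bv k = 1 := by
      simp only [hBv]
      rw [← Finset.sum_div, Finset.sum_add_distrib, ← hB]
      simp only [Finset.sum_const, Nat.card_Icc, nsmul_eq_mul, Nat.add_sub_cancel]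
      field_simp; ring
    have e2 : ∑ k ∈ Finset.Icc 1 n, Rv k = 1 := by
      simp only [hRv]
      rw [← Finset.sum_div, Finset.sum_add_distrib, ← hR]
      simp only [Finset.sum_const, Nat.card_Icc, nsmul_eq_mul, Nat.add_sub_cancel]
      field_simp; ring
    simp only [hE]
    rw [Finset.sum_add_distrib, ← Finset.mul_sum, ← Finset.mul_sum, e1, e2]; ring
  · intro j hj
    rw [Finset.mem_Icc] at hj
    rcases le_total i j with h | h
    · have e1 : max (j - i) (i - j) = j - i := by omega
      have := hup (j - i) (by omega)
      rw [e1]; rwa [Nat.add_sub_cancel' h] at this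
    · have e1 : max (j - i) (i - j) = i - j := by omega
      rw [e1]
      exact hdn (i - j) j hj.1 (by omega)
  · have hEi : E i i * M ≤ 2 * C := by
      have h1 := (hb0 i hi'.1 hi'.2).2
      have h2 := (hr0 i hi'.1 hi'.2).2
      have e : E i i * M = p i * (b i + (M - B) / n) + (1 - p i) * (r i + (M - R) / n) := by
        rw [hE, hBv, hRv]; field_simp
      rw [e]
      have h3 : p i * (b i + (M - B) / n) ≤ p i * (2 * C) :=
        mul_le_mul_of_nonneg_left (by linarith [hcB.2]) hpi0
      have h4 : (1 - p i) * (r i + (M - R) / n) ≤ (1 - p i) * (2 * C) :=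
        mul_le_mul_of_nonneg_left (by linarith [hcR.2]) (by linarith)
      linarith
    have hm' : 108 * M * ((n : ℝ) - 1) * ε⁻¹ * Real.log (4 / η) ≤ (m : ℝ) := by
      have := Int.le_ceil (108 * M * ((n : ℝ) - 1) * ε⁻¹ * Real.log (4 / η))
      rw [← hm] at this
      exact_mod_cast this
    refine le_trans ?_ hm'
    have e2 : 108 * M * ((n : ℝ) - 1) * ε⁻¹ * Real.log (4 / η)
        = 54 * (Real.log (4 / η) * M * C) := by rw [hC]; field_simp; ring
    have e3 : Real.log (4 / η) * (4 * E i i) * M ^ 2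
        = 4 * (Real.log (4 / η) * M * (E i i * M)) := by ring
    rw [e2, e3]
    have h5 : Real.log (4 / η) * M * (E i i * M) ≤ Real.log (4 / η) * M * (2 * C) :=
      mul_le_mul_of_nonneg_left hEi (by positivity)
    have h6 : 0 ≤ Real.log (4 / η) * M * C := by positivity
    linarith
end

section
/- There exist universal constants H ∈ (0,1), c₁ > 0 and c₂ > 0 with the following property. Let η ∈ (0,H), let n ≥ 120, let 0 < ε ≤ 1/(11(n−1)), and let m ≤ c₁·n³·ε^{−2}·ln(1/η). Then for every voting scheme for I(n,ε) with m voters there exists an urn i ∈ {1,…,n} such that, when each voter t independently votes for urn j with probability p_i·B_{j,t} + (1−p_i)·R_{j,t}, the probability that urn i receives strictly more votes than every other urn is at most 1 − c₂·η. -/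
lemma quad_lower (u : ℝ) (hu : -2 ≤ u) : 1 + u + u ^ 2 / 4 ≤ Real.exp u := by
  have h1 : 1 + u / 2 ≤ Real.exp (u / 2) := by linarith [Real.add_one_le_exp (u / 2)]
  have h2 : Real.exp u = Real.exp (u / 2) ^ 2 := by
    rw [← Real.exp_nat_mul]; congr 1; push_cast; ring
  rw [h2]
  nlinarith

lemma quad_upper (u : ℝ) (hu : |u| ≤ 1) : Real.exp u ≤ 1 + u + u ^ 2 := by
  have := Real.abs_exp_sub_one_sub_id_le hu
  linarith [(abs_le.mp this).2]

lemma voter_lower (x y l : ℝ) (hx : 0 ≤ x) (hy : 0 ≤ y) (hxy : x + y ≤ 1)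
    (hl : 0 ≤ l) (hl' : l ≤ 1 / 4) :
    Real.exp (-l * (x - y) + (l ^ 2 / 8) * (x + y - (x - y) ^ 2)) ≤
      1 + x * (Real.exp (-l) - 1) + y * (Real.exp l - 1) := by
  have hm1 : x - y ≤ 1 := by linarith
  have hm2 : -1 ≤ x - y := by linarith
  have a1 := quad_lower (-l * (1 - (x - y))) (by nlinarith)
  have a2 := quad_lower (-l * (-1 - (x - y))) (by nlinarith)
  have a3 := quad_lower (l * (x - y)) (by nlinarith)
  have e1 : Real.exp (-l) = Real.exp (-l * (x - y)) * Real.exp (-l * (1 - (x - y))) := by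
    rw [← Real.exp_add]; congr 1; ring
  have e2 : Real.exp l = Real.exp (-l * (x - y)) * Real.exp (-l * (-1 - (x - y))) := by
    rw [← Real.exp_add]; congr 1; ring
  have e3 : 1 = Real.exp (-l * (x - y)) * Real.exp (l * (x - y)) := by
    rw [← Real.exp_add, ← Real.exp_zero]; congr 1; ring
  have hV0 : 0 ≤ x + y - (x - y) ^ 2 := by nlinarith
  have hV1 : x + y - (x - y) ^ 2 ≤ 1 := by nlinarith [sq_nonneg (x - y)]
  have hb : Real.exp ((l ^ 2 / 8) * (x + y - (x - y) ^ 2)) ≤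
      1 + (l ^ 2 / 4) * (x + y - (x - y) ^ 2) := by
    set w := (l ^ 2 / 8) * (x + y - (x - y) ^ 2) with hw
    have hw0 : 0 ≤ w := by positivity
    have hw1 : w ≤ 1 := by
      have : l ^ 2 / 8 ≤ 1 := by nlinarith
      nlinarith
    have := quad_upper w (by rw [abs_of_nonneg hw0]; exact hw1)
    nlinarith
  have key : 1 + (l ^ 2 / 4) * (x + y - (x - y) ^ 2) ≤
      x * Real.exp (-l * (1 - (x - y))) + y * Real.exp (-l * (-1 - (x - y)))
        + (1 - x - y) * Real.exp (l * (x - y)) := by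
    have b1 := mul_le_mul_of_nonneg_left a1 hx
    have b2 := mul_le_mul_of_nonneg_left a2 hy
    have b3 := mul_le_mul_of_nonneg_left a3 (by linarith : 0 ≤ 1 - x - y)
    refine le_trans (le_of_eq ?_) (add_le_add (add_le_add b1 b2) b3)
    ring
  rw [Real.exp_add]
  calc _ ≤ Real.exp (-l * (x - y)) * (x * Real.exp (-l * (1 - (x - y)))
        + y * Real.exp (-l * (-1 - (x - y))) + (1 - x - y) * Real.exp (l * (x - y))) :=
        mul_le_mul_of_nonneg_left (hb.trans key) (Real.exp_pos _).le
    _ = x * Real.exp (-l) + y * Real.exp l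
        + (1 - x - y) * (Real.exp (-l * (x - y)) * Real.exp (l * (x - y))) := by
        rw [e1, e2]; ring
    _ = _ := by rw [← e3]; ring

lemma voter_upper (x y l : ℝ) (hx : 0 ≤ x) (hy : 0 ≤ y) (hxy : x + y ≤ 1)
    (hl : 0 ≤ l) (hl' : l ≤ 1 / 2) :
    1 + x * (Real.exp (-l) - 1) + y * (Real.exp l - 1) ≤
    Real.exp (-l * (x - y) + l ^ 2 * (x + y - (x - y) ^ 2)) := by
  have hm1 : x - y ≤ 1 := by linarith
  have hm2 : -1 ≤ x - y := by linarith
  have a1 := quad_upper (-l * (1 - (x - y))) (by rw [abs_le]; constructor <;> nlinarith)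
  have a2 := quad_upper (-l * (-1 - (x - y))) (by rw [abs_le]; constructor <;> nlinarith)
  have a3 := quad_upper (l * (x - y)) (by rw [abs_le]; constructor <;> nlinarith)
  have e1 : Real.exp (-l) = Real.exp (-l * (x - y)) * Real.exp (-l * (1 - (x - y))) := by
    rw [← Real.exp_add]; congr 1; ring
  have e2 : Real.exp l = Real.exp (-l * (x - y)) * Real.exp (-l * (-1 - (x - y))) := by
    rw [← Real.exp_add]; congr 1; ring
  have e3 : 1 = Real.exp (-l * (x - y)) * Real.exp (l * (x - y)) := by
    rw [← Real.exp_add, ← Real.exp_zero]; congr 1; ring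
  have hb : 1 + l ^ 2 * (x + y - (x - y) ^ 2) ≤
      Real.exp (l ^ 2 * (x + y - (x - y) ^ 2)) := by
    linarith [Real.add_one_le_exp (l ^ 2 * (x + y - (x - y) ^ 2))]
  have key : x * Real.exp (-l * (1 - (x - y))) + y * Real.exp (-l * (-1 - (x - y)))
        + (1 - x - y) * Real.exp (l * (x - y)) ≤ 1 + l ^ 2 * (x + y - (x - y) ^ 2) := by
    have b1 := mul_le_mul_of_nonneg_left a1 hx
    have b2 := mul_le_mul_of_nonneg_left a2 hy
    have b3 := mul_le_mul_of_nonneg_left a3 (by linarith : 0 ≤ 1 - x - y)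
    refine le_trans (add_le_add (add_le_add b1 b2) b3) (le_of_eq ?_)
    ring
  rw [Real.exp_add]
  calc _ = x * Real.exp (-l) + y * Real.exp l
        + (1 - x - y) * (Real.exp (-l * (x - y)) * Real.exp (l * (x - y))) := by
        rw [← e3]; ring
    _ = Real.exp (-l * (x - y)) * (x * Real.exp (-l * (1 - (x - y)))
        + y * Real.exp (-l * (-1 - (x - y))) + (1 - x - y) * Real.exp (l * (x - y))) := by
        rw [e1, e2]; ring
    _ ≤ _ := mul_le_mul_of_nonneg_left (key.trans hb) (Real.exp_pos _).le

/-- growth of a sequence with steps at least a square root -/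
lemma growth (K : ℝ) (hK : 0 ≤ K) (N : ℕ) (b : ℕ → ℝ) (h0 : 0 ≤ b 0)
    (hmono : ∀ k < N, b k ≤ b (k + 1))
    (hstep : ∀ k < N, K * b (k + 1) < (b (k + 1) - b k) ^ 2) :
    ∀ k ≤ N, (k : ℝ) ^ 2 * K / 4 ≤ b k := by
  intro k
  induction k with
  | zero => intro _; simpa using h0
  | succ k ih =>
    intro hk
    have h1 := ih (by omega)
    have h2 := hmono k (by omega)
    have h3 := hstep k (by omega)
    by_contra hcon
    push Not at hcon
    push_cast at hcon
    set D := b (k + 1) - b k with hD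
    have hb : b (k + 1) = b k + D := by rw [hD]; ring
    rw [hb] at h3 hcon
    have hD0 : 0 ≤ D := by rw [hD]; linarith
    have hD1 : D ≤ (2 * k + 1) * K / 4 := by nlinarith
    have hk0 : (0 : ℝ) ≤ k := Nat.cast_nonneg k
    have h4 : K * (k ^ 2 * K / 4 + D) < D ^ 2 := by
      nlinarith
    have h5 : D ^ 2 ≤ D * ((2 * k + 1) * K / 4) := by nlinarith
    -- D * ((2k+1)K/4 - K) > k^2 K^2/4
    have h6 : k ^ 2 * K ^ 2 / 4 < D * ((2 * k - 3) * K / 4) := by nlinarith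
    rcases le_total (2 * (k : ℝ) - 3) 0 with h | h
    · have : (2 * (k : ℝ) - 3) * K / 4 ≤ 0 := by nlinarith
      have : D * ((2 * k - 3) * K / 4) ≤ 0 := mul_nonpos_of_nonneg_of_nonpos hD0 this
      have : 0 ≤ (k : ℝ) ^ 2 * K ^ 2 / 4 := by positivity
      linarith
    · have h7 : D * ((2 * k - 3) * K / 4) ≤ (2 * k + 1) * K / 4 * ((2 * k - 3) * K / 4) :=
        mul_le_mul_of_nonneg_right hD1 (by positivity)
      nlinarith [mul_nonneg hk0 (sq_nonneg K), sq_nonneg K]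

lemma sum_sq_lower (N : ℕ) : (N : ℝ) ^ 3 / 3 ≤ ∑ k ∈ Finset.range (N + 1), (k : ℝ) ^ 2 := by
  induction N with
  | zero => simp
  | succ N ih =>
    rw [Finset.sum_range_succ]
    push_cast at *
    nlinarith [Nat.cast_nonneg (α := ℝ) N]

lemma growth_sum (K : ℝ) (hK : 0 ≤ K) (N : ℕ) (b : ℕ → ℝ) (h0 : 0 ≤ b 0)
    (hmono : ∀ k < N, b k ≤ b (k + 1))
    (hstep : ∀ k < N, K * b (k + 1) < (b (k + 1) - b k) ^ 2) :
    K * (N : ℝ) ^ 3 ≤ 12 * ∑ k ∈ Finset.range (N + 1), |b k| := by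
  have h := growth K hK N b h0 hmono hstep
  have h1 : ∑ k ∈ Finset.range (N + 1), (k : ℝ) ^ 2 * (K / 4) ≤
      ∑ k ∈ Finset.range (N + 1), |b k| := by
    refine Finset.sum_le_sum fun k hk => ?_
    have := h k (by simpa [Nat.lt_succ_iff] using hk)
    have := le_abs_self (b k)
    linarith
  rw [← Finset.sum_mul] at h1
  nlinarith [sum_sq_lower N]

lemma comb (n : ℕ) (hn : 120 ≤ n) (a : ℕ → ℝ) (K : ℝ) (hK : 0 ≤ K)
    (hmono : ∀ j, 1 ≤ j → j + 1 ≤ n → a j ≤ a (j + 1))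
    (h1 : ∀ j, 1 ≤ j → j + 1 ≤ n → K * |a j| < (a (j + 1) - a j) ^ 2)
    (h2 : ∀ j, 1 ≤ j → j + 1 ≤ n → K * |a (j + 1)| < (a (j + 1) - a j) ^ 2) :
    K * (n : ℝ) ^ 3 ≤ 324 * ∑ j ∈ Finset.Icc 1 n, |a j| := by
  obtain ⟨N, hN1, hN2⟩ : ∃ N : ℕ, 2 * N + 1 ≤ n ∧ n ≤ 3 * N := ⟨(n - 1) / 2, by omega, by omega⟩
  have hsub : ∀ f : ℕ → ℕ, Set.InjOn f (Finset.range (N + 1)) →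
      (∀ k ∈ Finset.range (N + 1), f k ∈ Finset.Icc 1 n) →
      ∑ k ∈ Finset.range (N + 1), |a (f k)| ≤ ∑ j ∈ Finset.Icc 1 n, |a j| := by
    intro f hf hm
    rw [← Finset.sum_image (f := fun j => |a j|) hf]
    refine Finset.sum_le_sum_of_subset_of_nonneg ?_ fun _ _ _ => abs_nonneg _
    exact Finset.image_subset_iff.mpr hm
  have main : K * (N : ℝ) ^ 3 ≤ 12 * ∑ j ∈ Finset.Icc 1 n, |a j| := by
    rcases le_total 0 (a (N + 1)) with h | h
    · refine (growth_sum K hK N (fun k => a (N + 1 + k)) (by simpa using h) ?_ ?_).trans ?_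
      · intro k hk
        exact hmono (N + 1 + k) (by omega) (by omega)
      · intro k hk
        have := h2 (N + 1 + k) (by omega) (by omega)
        refine lt_of_le_of_lt ?_ this
        exact mul_le_mul_of_nonneg_left (le_abs_self _) hK
      · refine mul_le_mul_of_nonneg_left (hsub (fun k => N + 1 + k) ?_ ?_) (by norm_num)
        · intro p _ q _ hpq; simpa using hpq
        · intro k hk; simp at hk ⊢; omega
    · refine le_trans (growth_sum K hK N (fun k => - a (N + 1 - k)) (by simpa using h) ?_ ?_) ?_
      · intro k hk
        have := hmono (N + 1 - (k + 1)) (by omega) (by omega)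
        rw [show N + 1 - (k + 1) + 1 = N + 1 - k by omega] at this
        simpa using this
      · intro k hk
        have := h1 (N + 1 - (k + 1)) (by omega) (by omega)
        rw [show N + 1 - (k + 1) + 1 = N + 1 - k by omega] at this
        refine lt_of_le_of_lt ?_ (lt_of_lt_of_eq this ?_)
        · exact mul_le_mul_of_nonneg_left (neg_le_abs _) hK
        · ring
      · simp only [abs_neg]
        refine mul_le_mul_of_nonneg_left (hsub (fun k => N + 1 - k) ?_ ?_) (by norm_num)
        · intro p hp q hq hpq
          simp at hp hq hpq; omega
        · intro k hk; simp at hk ⊢; omega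
  have hc : (n : ℝ) ^ 3 ≤ 27 * (N : ℝ) ^ 3 := by
    have : (n : ℝ) ≤ 3 * N := by exact_mod_cast hN2
    calc (n : ℝ) ^ 3 ≤ (3 * N) ^ 3 := by gcongr
      _ = _ := by ring
  nlinarith [mul_le_mul_of_nonneg_left hc hK]

def dd (i j k : ℕ) : ℤ := if k = i then 1 else if k = j then -1 else 0

lemma voter_sum (S : Finset ℕ) (w : ℕ → ℝ) (hw : ∑ k ∈ S, w k = 1) (i j : ℕ) (hi : i ∈ S)
    (hj : j ∈ S) (hij : i ≠ j) (l : ℝ) :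
    ∑ k ∈ S, w k * Real.exp (-l * (dd i j k : ℝ)) =
      1 + w i * (Real.exp (-l) - 1) + w j * (Real.exp l - 1) := by
  have h : ∀ k ∈ S, w k * Real.exp (-l * (dd i j k : ℝ)) =
      w k + (if k = i then w k * (Real.exp (-l) - 1) else 0)
        + (if k = j then w k * (Real.exp l - 1) else 0) := by
    intro k _
    unfold dd
    by_cases h1 : k = i
    · have h2 : k ≠ j := fun h => hij (h1 ▸ h)
      simp [h1, hij]; ring
    · by_cases h2 : k = j
      · simp [h2, hij.symm]; ring
      · simp [h1, h2]
  rw [Finset.sum_congr rfl h, Finset.sum_add_distrib, Finset.sum_add_distrib, hw,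
    Finset.sum_ite_eq' , Finset.sum_ite_eq', if_pos hi, if_pos hj]

lemma Zprod (m : ℕ) (S : Finset ℕ) (w : Fin m → ℕ → ℝ) (hw : ∀ t, ∑ k ∈ S, w t k = 1)
    (i j : ℕ) (hi : i ∈ S) (hj : j ∈ S) (hij : i ≠ j) (l : ℝ) :
    ∑ v ∈ Fintype.piFinset (fun _ : Fin m => S),
      (∏ t, w t (v t)) * Real.exp (-l * ((∑ t, dd i j (v t) : ℤ) : ℝ)) =
    ∏ t, (1 + w t i * (Real.exp (-l) - 1) + w t j * (Real.exp l - 1)) := by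
  rw [← Finset.prod_congr rfl fun t _ => voter_sum S (w t) (hw t) i j hi hj hij l,
    Finset.prod_univ_sum]
  refine Finset.sum_congr rfl fun v _ => ?_
  rw [Finset.prod_mul_distrib, ← Real.exp_sum, Int.cast_sum, Finset.mul_sum]

/-- second moment bound -/
lemma second_moment {α : Type*} (T : Finset α) (W : α → ℝ) (hW : ∀ v ∈ T, 0 ≤ W v)
    (hW1 : ∑ v ∈ T, W v = 1)
    (D : α → ℤ) (l : ℝ) (hl : 0 ≤ l) (Z1 Z2 : ℝ)
    (hZ1 : ∑ v ∈ T, W v * Real.exp (-l * (D v : ℝ)) = Z1)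
    (hZ2 : ∑ v ∈ T, W v * Real.exp (-(2 * l) * (D v : ℝ)) = Z2)
    (hpos : Real.exp (-l) ≤ Z1) :
    (Z1 - Real.exp (-l)) ^ 2 ≤ (∑ v ∈ T, if D v ≤ 0 then W v else 0) * Z2 := by
  have h1 : Z1 - Real.exp (-l) ≤
      ∑ v ∈ T, if D v ≤ 0 then W v * Real.exp (-l * (D v : ℝ)) else 0 := by
    have : Z1 ≤ ∑ v ∈ T, ((if D v ≤ 0 then W v * Real.exp (-l * (D v : ℝ)) else 0)
        + W v * Real.exp (-l)) := by
      rw [← hZ1]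
      refine Finset.sum_le_sum fun v hv => ?_
      split_ifs with h
      · have := mul_nonneg (hW v hv) (Real.exp_pos (-l)).le
        linarith
      · rw [zero_add]
        refine mul_le_mul_of_nonneg_left (Real.exp_le_exp.mpr ?_) (hW v hv)
        have : (1 : ℝ) ≤ D v := by exact_mod_cast (by omega : (1 : ℤ) ≤ D v)
        nlinarith
    rw [Finset.sum_add_distrib, ← Finset.sum_mul, hW1] at this
    linarith
  calc (Z1 - Real.exp (-l)) ^ 2 ≤
      (∑ v ∈ T, if D v ≤ 0 then W v * Real.exp (-l * (D v : ℝ)) else 0) ^ 2 := by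
        apply pow_le_pow_left₀ (by linarith) h1
    _ ≤ _ := by
      rw [← hZ2]
      apply Finset.sum_sq_le_sum_mul_sum_of_sq_le_mul
      · intro v hv; split_ifs
        · exact hW v hv
        · exact le_rfl
      · intro v hv
        exact mul_nonneg (hW v hv) (Real.exp_pos _).le
      · intro v hv
        apply le_of_eq
        split_ifs
        · rw [mul_pow, ← Real.exp_nat_mul, pow_two, mul_assoc]
          congr 3
          push_cast; ring
        · simp

lemma tail_l (m : ℕ) (S : Finset ℕ) (w : Fin m → ℕ → ℝ) (hw : ∀ t, ∑ k ∈ S, w t k = 1)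
    (hw0 : ∀ t, ∀ k ∈ S, 0 ≤ w t k)
    (i j : ℕ) (hi : i ∈ S) (hj : j ∈ S) (hij : i ≠ j) (l M V q : ℝ) (hl : 0 ≤ l) (hl' : l ≤ 1 / 4)
    (hM : M = ∑ t, (w t i - w t j))
    (hV : V = ∑ t, (w t i + w t j - (w t i - w t j) ^ 2))
    (hq1 : q ≤ 1)
    (hq : Real.exp (-l) ≤ q * Real.exp (-l * M + l ^ 2 / 8 * V)) :
    (1 - q) ^ 2 * Real.exp (- (4 * l ^ 2 * V)) ≤
      ∑ v ∈ Fintype.piFinset (fun _ : Fin m => S),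
        if (∑ t, dd i j (v t)) ≤ 0 then ∏ t, w t (v t) else 0 := by
  have hsum : ∀ t, w t i + w t j ≤ 1 := by
    intro t
    rw [← hw t, ← Finset.sum_pair hij]
    refine Finset.sum_le_sum_of_subset_of_nonneg ?_ fun k hk _ => hw0 t k hk
    intro k hk
    simp at hk
    rcases hk with rfl | rfl <;> assumption
  have hW1 : ∑ v ∈ Fintype.piFinset (fun _ : Fin m => S), ∏ t, w t (v t) = 1 := by
    rw [← Finset.prod_univ_sum]
    simp [hw]
  have hZ1 := Zprod m S w hw i j hi hj hij l
  have hZ2 := Zprod m S w hw i j hi hj hij (2 * l)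
  set Z1 := ∏ t, (1 + w t i * (Real.exp (-l) - 1) + w t j * (Real.exp l - 1)) with hZ1d
  set Z2 := ∏ t, (1 + w t i * (Real.exp (-(2 * l)) - 1) + w t j * (Real.exp (2 * l) - 1)) with hZ2d
  have lo : Real.exp (-l * M + l ^ 2 / 8 * V) ≤ Z1 := by
    rw [hM, hV, Finset.mul_sum, Finset.mul_sum, ← Finset.sum_add_distrib, Real.exp_sum]
    refine Finset.prod_le_prod (fun _ _ => (Real.exp_pos _).le) fun t _ => ?_
    exact voter_lower _ _ _ (hw0 t i hi) (hw0 t j hj) (hsum t) hl hl'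
  have up : Z2 ≤ Real.exp (-(2 * l) * M + (2 * l) ^ 2 * V) := by
    rw [hM, hV, Finset.mul_sum, Finset.mul_sum, ← Finset.sum_add_distrib, Real.exp_sum]
    refine Finset.prod_le_prod (fun t _ => ?_) fun t _ => ?_
    · nlinarith [mul_nonneg (hw0 t i hi) (Real.exp_pos (-(2 * l))).le, mul_nonneg (hw0 t j hj) (Real.exp_pos (2 * l)).le, hsum t]
    · exact voter_upper _ _ _ (hw0 t i hi) (hw0 t j hj) (hsum t) (by linarith) (by linarith)
  have hE := Real.exp_pos (-l * M + l ^ 2 / 8 * V)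
  have hpos : Real.exp (-l) ≤ Z1 := hq.trans (le_trans (by nlinarith) lo)
  have hW0 : ∀ v ∈ Fintype.piFinset (fun _ : Fin m => S), 0 ≤ ∏ t, w t (v t) := by
    intro v hv
    exact Finset.prod_nonneg fun t _ => hw0 t _ (Fintype.mem_piFinset.mp hv t)
  have sm := second_moment _ (fun v : Fin m → ℕ => ∏ t, w t (v t)) hW0 hW1
    (fun v => ∑ t, dd i j (v t)) l hl Z1 Z2 hZ1 hZ2 hpos
  set P := ∑ v ∈ Fintype.piFinset (fun _ : Fin m => S),
        if (∑ t, dd i j (v t)) ≤ 0 then ∏ t, w t (v t) else 0 with hP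
  have hP0 : 0 ≤ P := by
    refine Finset.sum_nonneg fun v hv => ?_
    split_ifs
    · exact hW0 v hv
    · exact le_rfl
  have hV0 : 0 ≤ V := by
    rw [hV]
    refine Finset.sum_nonneg fun t _ => ?_
    nlinarith [hw0 t i hi, hw0 t j hj, hsum t]
  set E := Real.exp (-l * M + l ^ 2 / 8 * V) with hEd
  have hEM : Real.exp (-l * M) ≤ E := Real.exp_le_exp.mpr (by nlinarith [sq_nonneg l, mul_nonneg (sq_nonneg l) hV0])
  have s1 : (1 - q) * Real.exp (-l * M) ≤ Z1 - Real.exp (-l) := by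
    have : (1 - q) * Real.exp (-l * M) ≤ (1 - q) * E :=
      mul_le_mul_of_nonneg_left hEM (by linarith)
    nlinarith
  have s2 : ((1 - q) * Real.exp (-l * M)) ^ 2 ≤ P * Real.exp (-(2 * l) * M + (2 * l) ^ 2 * V) :=
    (pow_le_pow_left₀ (mul_nonneg (by linarith) (Real.exp_pos _).le) s1 2).trans
      (sm.trans (mul_le_mul_of_nonneg_left up hP0))
  have e1 : ((1 - q) * Real.exp (-l * M)) ^ 2 =
      (1 - q) ^ 2 * Real.exp (- (4 * l ^ 2 * V)) * Real.exp (-(2 * l) * M + (2 * l) ^ 2 * V) := by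
    rw [mul_pow, ← Real.exp_nat_mul, mul_assoc, ← Real.exp_add]
    congr 2; push_cast; ring
  rw [e1] at s2
  exact le_of_mul_le_mul_right s2 (Real.exp_pos _)

lemma tail (m : ℕ) (S : Finset ℕ) (w : Fin m → ℕ → ℝ) (hw : ∀ t, ∑ k ∈ S, w t k = 1)
    (hw0 : ∀ t, ∀ k ∈ S, 0 ≤ w t k)
    (i j : ℕ) (hi : i ∈ S) (hj : j ∈ S) (hij : i ≠ j) (M V G : ℝ)
    (hM : M = ∑ t, (w t i - w t j))
    (hV : V = ∑ t, (w t i + w t j - (w t i - w t j) ^ 2))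
    (hV0 : 0 ≤ V) (hG : 0 ≤ G) (hMV : M ≤ V / 64) (hMG : 0 ≤ M → 512 * M ^ 2 ≤ G * V) :
    Real.exp (-128) / 25 * Real.exp (-G) ≤
      ∑ v ∈ Fintype.piFinset (fun _ : Fin m => S),
        if (∑ t, dd i j (v t)) ≤ 0 then ∏ t, w t (v t) else 0 := by
  rcases le_total V 512 with h | h
  · refine le_trans ?_ (tail_l m S w hw hw0 i j hi hj hij (1 / 4) M V (4 / 5) (by norm_num) le_rfl
      hM hV (by norm_num) ?_)
    · have a1 : Real.exp (-128) ≤ Real.exp (-(4 * (1 / 4) ^ 2 * V)) :=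
        Real.exp_le_exp.mpr (by linarith)
      have a2 : Real.exp (-G) ≤ 1 := Real.exp_le_one_iff.mpr (by linarith)
      have := Real.exp_pos (-128)
      nlinarith
    · have a1 : 1 ≤ Real.exp (-(1 / 4) * M + (1 / 4) ^ 2 / 8 * V) :=
        Real.one_le_exp (by linarith)
      have a2 : Real.exp (-(1 / 4)) ≤ 4 / 5 := by
        rw [Real.exp_neg, inv_le_comm₀ (Real.exp_pos _) (by norm_num)]
        linarith [Real.add_one_le_exp (1 / 4 : ℝ)]
      linarith
  · have hVp : 0 < V := by linarith
    set r := Real.sqrt V with hr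
    have hrr : r * r = V := Real.mul_self_sqrt hV0
    have hr16 : 16 * Real.sqrt 2 ≤ r := by
      rw [hr, show (16 : ℝ) * Real.sqrt 2 = Real.sqrt 512 by
        rw [show (512 : ℝ) = 16 ^ 2 * 2 by norm_num, Real.sqrt_mul (by norm_num),
          Real.sqrt_sq (by norm_num)]]
      exact Real.sqrt_le_sqrt h
    have hs2 : (1.4 : ℝ) ≤ Real.sqrt 2 := Real.le_sqrt_of_sq_le (by norm_num)
    have hrp : 0 < r := by linarith
    set A := max M 0 with hA
    have hA0 : 0 ≤ A := le_max_right _ _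
    have hAM : M ≤ A := le_max_left _ _
    have hAV : A ≤ V / 64 := max_le hMV (by linarith)
    have hAG : 512 * A ^ 2 ≤ G * V := by
      rcases le_total 0 M with h0 | h0
      · rw [hA, max_eq_left h0]; exact hMG h0
      · rw [hA, max_eq_right h0]; nlinarith
    -- choose the tilt
    set l := (8 * A + 2 * r) / V with hl
    have hlV : l * V = 8 * A + 2 * r := by rw [hl]; field_simp
    have hl0 : 0 ≤ l := by positivity
    have hl4 : l ≤ 1 / 4 := by
      rw [hl, div_le_iff₀ hVp]
      nlinarith
    have hlr : 2 ≤ l * r := by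
      have : 2 * r ≤ (l * r) * r := by rw [mul_assoc, hrr, hlV]; linarith
      exact le_of_mul_le_mul_right this hrp
    refine le_trans ?_ (tail_l m S w hw hw0 i j hi hj hij l M V (4 / 5) hl0 hl4
      hM hV (by norm_num) ?_)
    · have b1 : 4 * l ^ 2 * V ≤ G + 32 := by
        have : (l * V) ^ 2 ≤ 128 * A ^ 2 + 8 * V := by
          rw [hlV]
          nlinarith [sq_nonneg (8 * A - 2 * r)]
        have h3 : (4 * l ^ 2 * V) * V ≤ (G + 32) * V := by nlinarith
        exact le_of_mul_le_mul_right h3 hVp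
      have b2 : Real.exp (-128) * Real.exp (-G) ≤ Real.exp (-(4 * l ^ 2 * V)) := by
        rw [← Real.exp_add]
        exact Real.exp_le_exp.mpr (by linarith)
      linarith
    · have c1 : 1 / 2 ≤ -l * M + l ^ 2 / 8 * V := by
        have : -l * M + l ^ 2 / 8 * V = l * (l * V / 8 - M) := by ring
        rw [this, hlV]
        nlinarith
      have c2 : 1 / 2 + 1 ≤ Real.exp (-l * M + l ^ 2 / 8 * V) :=
        (Real.add_one_le_exp _).trans (Real.exp_le_exp.mpr c1)
      have c3 : Real.exp (-l) ≤ 1 := Real.exp_le_one_iff.mpr (by linarith)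
      linarith

lemma var_lower (B R p : ℝ) (hB0 : 0 ≤ B) (hB1 : B ≤ 1) (hR0 : 0 ≤ R) (hR1 : R ≤ 1)
    (hp0 : 5 / 11 ≤ p) (hp1 : p ≤ 6 / 11) :
    5 / 22 * |B - R| ≤ (p * B + (1 - p) * R) * (1 - (p * B + (1 - p) * R)) := by
  set x := p * B + (1 - p) * R with hx
  have h1 : 5 / 11 * |B - R| ≤ x := by
    rcases abs_cases (B - R) with ⟨h, _⟩ | ⟨h, _⟩ <;> rw [h, hx] <;> nlinarith
  have h2 : 5 / 11 * |B - R| ≤ 1 - x := by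
    rcases abs_cases (B - R) with ⟨h, _⟩ | ⟨h, _⟩ <;> rw [h, hx] <;> nlinarith
  have h0 := abs_nonneg (B - R)
  rcases le_total x (1 / 2) with h | h <;> nlinarith

lemma dd_sum (m : ℕ) (i j : ℕ) (hij : i ≠ j) (v : Fin m → ℕ) :
    ∑ t, dd i j (v t) = ((Finset.univ.filter (fun t : Fin m => v t = i)).card : ℤ) -
      ((Finset.univ.filter (fun t : Fin m => v t = j)).card : ℤ) := by
  rw [Finset.card_filter, Finset.card_filter]
  push_cast
  rw [← Finset.sum_sub_distrib]
  refine Finset.sum_congr rfl fun t _ => ?_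
  unfold dd
  by_cases h1 : v t = i
  · simp [h1, hij]
  · by_cases h2 : v t = j <;> simp [h1, h2, hij.symm]

open Classical in
lemma win_le (m : ℕ) (n : ℕ) (w : Fin m → ℕ → ℝ)
    (hw : ∀ t, ∑ k ∈ Finset.Icc 1 n, w t k = 1)
    (hw0 : ∀ t, ∀ k ∈ Finset.Icc 1 n, 0 ≤ w t k)
    (i j : ℕ) (hi : i ∈ Finset.Icc 1 n) (hj : j ∈ Finset.Icc 1 n) (hij : i ≠ j) (M V G : ℝ)
    (hM : M = ∑ t, (w t i - w t j))
    (hV : V = ∑ t, (w t i + w t j - (w t i - w t j) ^ 2))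
    (hV0 : 0 ≤ V) (hG : 0 ≤ G) (hMV : M ≤ V / 64) (hMG : 0 ≤ M → 512 * M ^ 2 ≤ G * V) :
    (∑ v ∈ Fintype.piFinset (fun _ : Fin m => Finset.Icc 1 n),
          if ∀ j ∈ Finset.Icc 1 n, j ≠ i →
                (Finset.univ.filter (fun t : Fin m => v t = j)).card <
                (Finset.univ.filter (fun t : Fin m => v t = i)).card
          then ∏ t : Fin m, w t (v t) else 0)
        ≤ 1 - Real.exp (-128) / 25 * Real.exp (-G) := by
  have h := tail m _ w hw hw0 i j hi hj hij M V G hM hV hV0 hG hMV hMG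
  have hW1 : ∑ v ∈ Fintype.piFinset (fun _ : Fin m => Finset.Icc 1 n), ∏ t, w t (v t) = 1 := by
    rw [← Finset.prod_univ_sum]
    simp [hw]
  rw [← hW1]
  refine le_sub_iff_add_le.mpr ((add_le_add le_rfl h).trans ?_)
  rw [← Finset.sum_add_distrib]
  refine Finset.sum_le_sum fun v hv => ?_
  have hv0 : 0 ≤ ∏ t, w t (v t) :=
    Finset.prod_nonneg fun t _ => hw0 t _ (Fintype.mem_piFinset.mp hv t)
  rw [dd_sum m i j hij v]
  split_ifs with h1 h2 h2
  · have := h1 j hj hij.symm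
    omega
  · simp
  · simp
  · simpa using hv0

/- STATEMENT 4: Lower bound: there are universal constants H ∈ (0,1), c₁, c₂ > 0 such that
for η ∈ (0,H), n ≥ 120, 0 < ε ≤ 1/(11(n−1)) and m ≤ c₁·n³·ε⁻²·ln(1/η), every voting
scheme for I(n,ε) with m voters has an urn i for which the probability that urn i
receives strictly more votes than every other urn is at most 1 − c₂·η. -/
open Classical in
theorem stmt_4 :
    ∃ H c₁ c₂ : ℝ, 0 < H ∧ H < 1 ∧ 0 < c₁ ∧ 0 < c₂ ∧
      ∀ (η : ℝ), 0 < η → η < H →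
      ∀ (n : ℕ), 120 ≤ n →
      ∀ (ε : ℝ), 0 < ε → ε ≤ 1 / (11 * ((n : ℝ) - 1)) →
      ∀ (m : ℕ), (m : ℝ) ≤ c₁ * (n : ℝ) ^ 3 / ε ^ 2 * Real.log (1 / η) →
      ∀ (Bvt Rvt : Fin m → ℕ → ℝ),
        (∀ t, (∀ j ∈ Finset.Icc 1 n, 0 ≤ Bvt t j) ∧ ∑ j ∈ Finset.Icc 1 n, Bvt t j = 1) →
        (∀ t, (∀ j ∈ Finset.Icc 1 n, 0 ≤ Rvt t j) ∧ ∑ j ∈ Finset.Icc 1 n, Rvt t j = 1) →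
      ∀ (p : ℕ → ℝ), (∀ i, p i = (1 - ε * ((n : ℝ) - 1)) / 2 + ((i : ℝ) - 1) * ε) →
      ∃ i ∈ Finset.Icc 1 n,
        (∑ v ∈ Fintype.piFinset (fun _ : Fin m => Finset.Icc 1 n),
          if ∀ j ∈ Finset.Icc 1 n, j ≠ i →
                (Finset.univ.filter (fun t : Fin m => v t = j)).card <
                (Finset.univ.filter (fun t : Fin m => v t = i)).card
          then ∏ t : Fin m, (p i * Bvt t (v t) + (1 - p i) * Rvt t (v t)) else 0)
        ≤ 1 - c₂ * η := by
  refine ⟨1 / 2, 1 / 2000000, Real.exp (-128) / 25, by norm_num, by norm_num, by norm_num,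
    by positivity, ?_⟩
  intro η hη0 hηH n hn ε hε0 hε1 m hm B R hB hR p hp
  by_contra hcon
  push Not at hcon
  set G := Real.log (1 / η) with hGd
  have hG : 0 < G := Real.log_pos (by rw [lt_div_iff₀ hη0]; linarith)
  have hGη : Real.exp (-G) = η := by
    rw [hGd, one_div, Real.log_inv, neg_neg, Real.exp_log hη0]
  have hnR : (120 : ℝ) ≤ n := by exact_mod_cast hn
  have hεn : ε * ((n : ℝ) - 1) ≤ 1 / 11 := by
    have : 0 < (n : ℝ) - 1 := by linarith
    rw [le_div_iff₀ (by positivity)] at hε1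
    linarith
  have hεs : ε ≤ 1 / 1309 := by nlinarith
  have hp0 : ∀ i ∈ Finset.Icc 1 n, 5 / 11 ≤ p i ∧ p i ≤ 6 / 11 := by
    intro i hi
    rw [Finset.mem_Icc] at hi
    have h1 : (1 : ℝ) ≤ i := by exact_mod_cast hi.1
    have h2 : (i : ℝ) ≤ n := by exact_mod_cast hi.2
    rw [hp i]
    constructor <;> nlinarith
  have hle1 : ∀ (f : ℕ → ℝ), (∀ j ∈ Finset.Icc 1 n, 0 ≤ f j) → ∑ j ∈ Finset.Icc 1 n, f j = 1 →
      ∀ j ∈ Finset.Icc 1 n, f j ≤ 1 := by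
    intro f h0 h1 j hj
    rw [← h1]
    exact Finset.single_le_sum h0 hj
  -- slopes and their absolute versions
  set a : ℕ → ℝ := fun k => ∑ t, (B t k - R t k) with ha
  set A : ℕ → ℝ := fun k => ∑ t, |B t k - R t k| with hA
  set b : ℕ → ℝ := fun k => ∑ t, R t k with hb
  have haA : ∀ k, |a k| ≤ A k := fun k => Finset.abs_sum_le_sum_abs _ _
  have hA2 : ∑ k ∈ Finset.Icc 1 n, |a k| ≤ 2 * m := by
    calc ∑ k ∈ Finset.Icc 1 n, |a k| ≤ ∑ k ∈ Finset.Icc 1 n, A k :=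
          Finset.sum_le_sum fun k _ => haA k
      _ = ∑ t, ∑ k ∈ Finset.Icc 1 n, |B t k - R t k| := Finset.sum_comm
      _ ≤ ∑ t : Fin m, (2 : ℝ) := by
          refine Finset.sum_le_sum fun t _ => ?_
          calc _ ≤ ∑ k ∈ Finset.Icc 1 n, (B t k + R t k) := by
                refine Finset.sum_le_sum fun k hk => ?_
                have h1 := (hB t).1 k hk
                have h2 := (hR t).1 k hk
                rw [abs_le]; constructor <;> linarith
            _ = 2 := by rw [Finset.sum_add_distrib, (hB t).2, (hR t).2]; norm_num
      _ = 2 * m := by simp [mul_comm]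
  -- the two-urn consequence
  have pair : ∀ i ∈ Finset.Icc 1 n, ∀ j ∈ Finset.Icc 1 n, i ≠ j →
      ∃ V, 5 / 22 * (A i + A j) ≤ V ∧ ∀ M, M = (b i - b j) + p i * (a i - a j) →
        M ≤ V / 64 → (0 ≤ M → 512 * M ^ 2 ≤ G * V) → False := by
    intro i hi j hj hij
    have hpi := hp0 i hi
    set w : Fin m → ℕ → ℝ := fun t k => p i * B t k + (1 - p i) * R t k with hw
    have hw0 : ∀ t, ∀ k ∈ Finset.Icc 1 n, 0 ≤ w t k := by
      intro t k hk
      have h1 := (hB t).1 k hk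
      have h2 := (hR t).1 k hk
      exact add_nonneg (mul_nonneg (by linarith) h1) (mul_nonneg (by linarith) h2)
    have hw1 : ∀ t, ∑ k ∈ Finset.Icc 1 n, w t k = 1 := by
      intro t
      simp only [hw]
      rw [Finset.sum_add_distrib, ← Finset.mul_sum, ← Finset.mul_sum, (hB t).2, (hR t).2]
      ring
    have hVl : 5 / 22 * (A i + A j) ≤ ∑ t, (w t i + w t j - (w t i - w t j) ^ 2) := by
      simp only [hA]
      rw [← Finset.sum_add_distrib, Finset.mul_sum]
      refine Finset.sum_le_sum fun t _ => ?_
      have v1 := var_lower (B t i) (R t i) (p i) ((hB t).1 i hi) (hle1 _ (hB t).1 (hB t).2 i hi)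
        ((hR t).1 i hi) (hle1 _ (hR t).1 (hR t).2 i hi) hpi.1 hpi.2
      have v2 := var_lower (B t j) (R t j) (p i) ((hB t).1 j hj) (hle1 _ (hB t).1 (hB t).2 j hj)
        ((hR t).1 j hj) (hle1 _ (hR t).1 (hR t).2 j hj) hpi.1 hpi.2
      change 5 / 22 * |B t i - R t i| ≤ w t i * (1 - w t i) at v1
      change 5 / 22 * |B t j - R t j| ≤ w t j * (1 - w t j) at v2
      nlinarith [mul_nonneg (hw0 t i hi) (hw0 t j hj)]
    refine ⟨∑ t, (w t i + w t j - (w t i - w t j) ^ 2), hVl, ?_⟩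
    intro M hM hMV hMG
    have hM' : M = ∑ t, (w t i - w t j) := by
      rw [hM]
      simp only [hb, ha, hw]
      rw [← Finset.sum_sub_distrib, ← Finset.sum_sub_distrib, Finset.mul_sum,
        ← Finset.sum_add_distrib]
      refine Finset.sum_congr rfl fun t _ => ?_
      ring
    have hA0 : ∀ k, 0 ≤ A k := fun k => (abs_nonneg _).trans (haA k)
    have := win_le m n w hw1 hw0 i j hi hj hij M _ G hM' rfl
      (by linarith [hA0 i, hA0 j]) hG.le hMV hMG
    rw [hGη] at this
    exact absurd this (not_le.mpr (hcon i hi))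
  have hA0 : ∀ k, 0 ≤ A k := fun k => (abs_nonneg _).trans (haA k)
  have posM : ∀ i ∈ Finset.Icc 1 n, ∀ j ∈ Finset.Icc 1 n, i ≠ j →
      0 < (b i - b j) + p i * (a i - a j) := by
    intro i hi j hj hij
    by_contra hle
    push Not at hle
    obtain ⟨V, hV, h⟩ := pair i hi j hj hij
    have hV0 : 0 ≤ V := by linarith [hA0 i, hA0 j]
    refine h _ rfl (by linarith) fun h0 => ?_
    rw [le_antisymm hle h0]
    nlinarith
  have step : ∀ j, 1 ≤ j → j + 1 ≤ n → 0 ≤ a (j + 1) - a j ∧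
      G * (5 / 22 * (A j + A (j + 1))) < 512 * ε ^ 2 * (a (j + 1) - a j) ^ 2 := by
    intro j hj1 hj2
    have hj : j ∈ Finset.Icc 1 n := Finset.mem_Icc.mpr ⟨hj1, by omega⟩
    have hj' : j + 1 ∈ Finset.Icc 1 n := Finset.mem_Icc.mpr ⟨by omega, hj2⟩
    have p1 := posM j hj (j + 1) hj' (by omega)
    have p2 := posM (j + 1) hj' j hj (by omega)
    have hpp : p (j + 1) = p j + ε := by rw [hp, hp]; push_cast; ring
    rw [hpp] at p2
    have hd : 0 ≤ a (j + 1) - a j := by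
      have : 0 < ε * (a (j + 1) - a j) := by nlinarith
      exact (pos_of_mul_pos_right this hε0.le).le
    refine ⟨hd, ?_⟩
    obtain ⟨V, hV, h⟩ := pair j hj (j + 1) hj' (by omega)
    set M := (b j - b (j + 1)) + p j * (a j - a (j + 1)) with hM
    have hMΔ : M ≤ ε * (a (j + 1) - a j) := by rw [hM]; nlinarith
    have hM2 : M ^ 2 ≤ ε ^ 2 * (a (j + 1) - a j) ^ 2 := by
      rw [← mul_pow]; exact pow_le_pow_left₀ p1.le hMΔ 2
    by_contra hle
    push Not at hle
    refine h M hM ?_ fun _ => ?_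
    · have q1 := (le_abs_self (a (j + 1))).trans (haA _)
      have q2 := (neg_abs_le (a j))
      have q3 := haA j
      have q4 : a (j + 1) - a j ≤ A j + A (j + 1) := by linarith
      have q5 : ε * (a (j + 1) - a j) ≤ 1 / 1309 * (A j + A (j + 1)) :=
        mul_le_mul hεs q4 hd (by norm_num)
      linarith [hA0 j, hA0 (j + 1)]
    · have := mul_le_mul_of_nonneg_left hV hG.le
      linarith
  have hε2 : 0 < ε ^ 2 := by positivity
  have hstep : ∀ j, 1 ≤ j → j + 1 ≤ n → ∀ x, x ≤ A j + A (j + 1) →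
      G * 5 / (11264 * ε ^ 2) * x < (a (j + 1) - a j) ^ 2 := by
    intro j h1 h2 x hx
    have h3 := (step j h1 h2).2
    have h4 := mul_le_mul_of_nonneg_left hx hG.le
    rw [div_mul_eq_mul_div, div_lt_iff₀ (by positivity)]
    nlinarith
  have hc := comb n hn a (G * 5 / (11264 * ε ^ 2)) (by positivity)
    (fun j h1 h2 => by linarith [(step j h1 h2).1])
    (fun j h1 h2 => hstep j h1 h2 _ (by linarith [haA j, hA0 (j + 1)]))
    (fun j h1 h2 => hstep j h1 h2 _ (by linarith [haA (j + 1), hA0 j]))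
  have hX : 0 < G * (n : ℝ) ^ 3 / ε ^ 2 := by positivity
  have e1 : G * 5 / (11264 * ε ^ 2) * (n : ℝ) ^ 3 = 5 / 11264 * (G * (n : ℝ) ^ 3 / ε ^ 2) := by
    field_simp
  have e2 : 1 / 2000000 * (n : ℝ) ^ 3 / ε ^ 2 * G = 1 / 2000000 * (G * (n : ℝ) ^ 3 / ε ^ 2) := by
    field_simp
  rw [e1] at hc
  rw [e2] at hm
  linarith
end

section
/- Assume the Conjecture on the coefficients b_{k,ℓ}. Then for every integer n ≥ 1 and all reals 0 ≤ p_1 < p_2 < ⋯ < p_n ≤ 1, there exists a probability distribution over the symmetric group S_n of permutations of {1,…,n} such that for all 1 ≤ i < j ≤ n, the probability that a random permutation π satisfies π(i) < π(j) equals min(1, 1/(p_i + p_j)). -/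
open MeasureTheory ProbabilityTheory

lemma sort_symm_lt {n : ℕ} (ω : Fin n → ℝ) {i j : Fin n} (hij : i < j) :
    (Tuple.sort ω).symm i < (Tuple.sort ω).symm j ↔ ω i ≤ ω j := by
  obtain ⟨hm, ht⟩ := (Tuple.eq_sort_iff (f := ω) (σ := Tuple.sort ω)).1 rfl
  constructor
  · intro h
    have := hm h.le
    simpa using this
  · intro h
    by_contra hc
    rw [not_lt] at hc
    have h1 := hm hc
    simp only [Function.comp, Equiv.apply_symm_apply] at h1
    have heq : ω i = ω j := le_antisymm h h1
    rcases hc.lt_or_eq with hc | hc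
    · have := ht _ _ hc (by simp [heq])
      simp only [Equiv.apply_symm_apply] at this
      exact absurd this (not_lt.2 hij.le)
    · have := (Tuple.sort ω).symm.injective hc
      exact absurd this hij.ne'

lemma measurableSet_sort {n : ℕ} (π : Equiv.Perm (Fin n)) :
    MeasurableSet {ω : Fin n → ℝ | (Tuple.sort ω).symm = π} := by
  have : {ω : Fin n → ℝ | (Tuple.sort ω).symm = π} =
      {ω | (∀ i j, i ≤ j → ω (π⁻¹ i) ≤ ω (π⁻¹ j)) ∧
        ∀ i j, i < j → ω (π⁻¹ i) = ω (π⁻¹ j) → π⁻¹ i < π⁻¹ j} := by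
    ext ω
    simp only [Set.mem_ofPred_eq]
    have : (Tuple.sort ω).symm = π ↔ π⁻¹ = Tuple.sort ω := by
      change (Tuple.sort ω)⁻¹ = π ↔ _
      rw [inv_eq_iff_eq_inv, eq_comm]
    rw [this, Tuple.eq_sort_iff]
    rfl
  rw [this]
  measurability

lemma exists_perm_dist {n : ℕ} (μ : Fin n → Measure ℝ) [∀ i, IsProbabilityMeasure (μ i)] :
    ∃ w : Equiv.Perm (Fin n) → ℝ,
      (∀ π, 0 ≤ w π) ∧ (∑ π : Equiv.Perm (Fin n), w π = 1) ∧
      ∀ i j : Fin n, i < j →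
        ∑ π ∈ Finset.univ.filter (fun π : Equiv.Perm (Fin n) => π i < π j), w π =
          ((μ i).prod (μ j)).real {q | q.1 ≤ q.2} := by
  classical
  set M := Measure.pi μ
  have key : ∀ s : Finset (Equiv.Perm (Fin n)),
      ∑ π ∈ s, M.real {ω : Fin n → ℝ | (Tuple.sort ω).symm = π} =
        M.real {ω | (Tuple.sort ω).symm ∈ s} := by
    intro s
    rw [← measureReal_biUnion_finset]
    · congr 1
      ext ω; simp
    · intro a _ b _ hab
      rw [Function.onFun, Set.disjoint_left]
      intro ω h1 h2
      exact hab (h1.symm.trans h2)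
    · intro π _; exact measurableSet_sort π
  refine ⟨fun π => M.real {ω : Fin n → ℝ | (Tuple.sort ω).symm = π}, fun _ => measureReal_nonneg, ?_, ?_⟩
  · rw [key]; simp
  · intro i j hij
    rw [key]
    have hmap : M.map (fun ω => (ω i, ω j)) = (μ i).prod (μ j) := by
      have h := iIndepFun_pi (μ := μ) (X := fun i (x : ℝ) => x) (fun i => aemeasurable_id)
      have h2 := h.indepFun hij.ne
      rw [indepFun_iff_map_prod_eq_prod_map_map (measurable_pi_apply i).aemeasurable (measurable_pi_apply j).aemeasurable] at h2
      rw [h2]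
      congr 1
      · exact (measurePreserving_eval μ i).map_eq
      · exact (measurePreserving_eval μ j).map_eq
    rw [← hmap, map_measureReal_apply (by fun_prop) (measurableSet_le measurable_fst measurable_snd)]
    congr 1
    ext ω
    simp [sort_symm_lt ω hij]

lemma hs_congr {ι : Type*} {f g : ι → ℝ} {a c : ℝ} (h : HasSum f a) (hf : ∀ x, g x = f x)
    (ha : c = a) : HasSum g c := by
  obtain rfl : g = f := funext hf
  rwa [ha]

lemma hasSum_int_aux {ι : Type*} [Countable ι] (f : ι → ℝ → ℝ) (F : ℝ → ℝ) (u : ι → ℝ) {Q : ℝ}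
    (hQ : 0 ≤ Q) (hc : ∀ i, Continuous (f i)) (hu : Summable u)
    (hb : ∀ i, ∀ x, 0 ≤ x → x ≤ Q → |f i x| ≤ u i)
    (hF : ∀ x, 0 ≤ x → x ≤ Q → HasSum (fun i => f i x) (F x)) :
    HasSum (fun i => ∫ x in (0:ℝ)..Q, f i x) (∫ x in (0:ℝ)..Q, F x) := by
  apply intervalIntegral.hasSum_integral_of_dominated_convergence (fun i _ => u i)
  · intro i; exact (hc i).aestronglyMeasurable
  · intro i
    refine Filter.Eventually.of_forall fun x hx => ?_
    rw [Set.uIoc_of_le hQ] at hx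
    exact hb i x hx.1.le hx.2
  · exact Filter.Eventually.of_forall fun x hx => hu
  · simp
  · refine Filter.Eventually.of_forall fun x hx => ?_
    rw [Set.uIoc_of_le hQ] at hx
    exact hF x hx.1.le hx.2

lemma hasSum_regroup2 {f : ℕ × ℕ → ℝ} {S : ℝ} (h : HasSum f S) :
    HasSum (fun k => ∑ i ∈ Finset.range (k + 1), f (i, k - i)) S := by
  have h2 := (Finset.HasAntidiagonal.sigmaAntidiagonalEquivProd (A := ℕ)).hasSum_iff.2 h
  have h3 := h2.sigma (fun k => hasSum_fintype _)
  convert h3 using 2 with k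
  rw [← Finset.Nat.sum_antidiagonal_eq_sum_range_succ_mk]
  exact (Finset.sum_coe_sort (Finset.HasAntidiagonal.antidiagonal k) f).symm

def triMap (x : Σ k : ℕ, Σ i : Fin (k + 1), Fin (k + 1 - (i : ℕ))) : ℕ × ℕ × ℕ :=
  ((x.2.1 : ℕ), (x.2.2 : ℕ), x.1 - x.2.1 - x.2.2)

lemma triMap_bij : Function.Bijective triMap := by
  constructor
  · rintro ⟨k, i, j⟩ ⟨k', i', j'⟩ h
    have hi := i.2
    have hj := j.2
    have hi' := i'.2
    have hj' := j'.2
    simp only [triMap, Prod.mk.injEq] at h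
    obtain ⟨h1, h2, h3⟩ := h
    obtain rfl : k = k' := by omega
    obtain rfl : i = i' := Fin.ext h1
    obtain rfl : j = j' := Fin.ext h2
    rfl
  · rintro ⟨i, j, m⟩
    refine ⟨⟨i + j + m, ⟨i, by omega⟩, ⟨j, by simp; omega⟩⟩, ?_⟩
    simp only [triMap, Prod.mk.injEq, true_and]
    omega

lemma hasSum_regroup3 {f : ℕ × ℕ × ℕ → ℝ} {S : ℝ} (h : HasSum f S) :
    HasSum (fun k => ∑ i ∈ Finset.range (k + 1), ∑ j ∈ Finset.range (k + 1 - i),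
      f (i, j, k - i - j)) S := by
  have h2 := (Equiv.ofBijective triMap triMap_bij).hasSum_iff.2 h
  have h3 := h2.sigma (fun k => hasSum_fintype _)
  convert h3 using 2 with k
  rw [Fintype.sum_sigma, Finset.sum_range]
  refine Finset.sum_congr rfl fun i _ => ?_
  rw [Finset.sum_range]
  rfl

/-- the double binomial series -/
lemma hasSum_binom {a c : ℝ} (h : |a| + |c| < 1) :
    HasSum (fun kl : ℕ × ℕ => ((kl.1 + kl.2).choose kl.1 : ℝ) * a ^ kl.1 * c ^ kl.2)
      (1 / (1 - a - c)) := by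
  have key : ∀ a c : ℝ, ∀ k : ℕ, ∑ i ∈ Finset.range (k + 1),
      ((i + (k - i)).choose i : ℝ) * a ^ i * c ^ (k - i) = (a + c) ^ k := by
    intro a c k
    rw [add_pow]
    refine Finset.sum_congr rfl fun i hi => ?_
    have : i + (k - i) = k := by have := Finset.mem_range.1 hi; omega
    rw [this]; ring
  have hs : Summable (fun kl : ℕ × ℕ => ((kl.1 + kl.2).choose kl.1 : ℝ) * a ^ kl.1 * c ^ kl.2) := by
    apply Summable.of_norm
    rw [← (Finset.HasAntidiagonal.sigmaAntidiagonalEquivProd (A := ℕ)).summable_iff]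
    rw [summable_sigma_of_nonneg (fun _ => by simp only [Function.comp]; exact norm_nonneg _)]
    refine ⟨fun k => (hasSum_fintype _).summable, ?_⟩
    have hg : Summable (fun k : ℕ => (|a| + |c|) ^ k) :=
      summable_geometric_of_lt_one (by positivity) h
    convert hg using 2 with k
    rw [← key |a| |c| k, ← Finset.Nat.sum_antidiagonal_eq_sum_range_succ
      (fun i j => ((i + j).choose i : ℝ) * |a| ^ i * |c| ^ j), tsum_fintype,
      ← Finset.sum_coe_sort (Finset.HasAntidiagonal.antidiagonal k)]
    refine Finset.sum_congr rfl fun x _ => ?_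
    simp
  have h1 := hasSum_regroup2 hs.hasSum
  have h2 : HasSum (fun k : ℕ => (a + c) ^ k) (1 - (a + c))⁻¹ := by
    apply hasSum_geometric_of_norm_lt_one
    exact lt_of_le_of_lt (abs_add_le a c) h
  have h3 := h1.unique (by simpa only [key] using h2)
  have := hs.hasSum
  rw [h3] at this
  convert this using 1
  rw [one_div]; congr 1; ring

lemma hasSum_lin {a c : ℝ} (ha : |a| < 1) (hc : |c| < 1) :
    HasSum (fun kl : ℕ × ℕ => a ^ kl.1 * (((kl.2 : ℝ) + 1) * c ^ kl.2))
      (1 / ((1 - a) * (1 - c) ^ 2)) := by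
  have h1 := hasSum_geometric_of_norm_lt_one (ξ := a) ha
  have h2 := hasSum_choose_mul_geometric_of_norm_lt_one (r := c) 1 hc
  simp only [Nat.choose_one_right, Nat.cast_add, Nat.cast_one] at h2
  have h3 := h1.mul h2 (summable_mul_of_summable_norm h1.summable.norm h2.summable.norm)
  refine hs_congr h3 (fun _ => rfl) ?_
  rw [inv_eq_one_div, div_mul_div_comm, one_mul]

noncomputable def cc (k l : ℕ) : ℝ := (-1 : ℝ) ^ (k + l) * ((k + l).choose k : ℝ) -
            ((-1 : ℝ) ^ l * ((k + l).choose k : ℝ) +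
              (-1 : ℝ) ^ (k + l) * ((l : ℝ) + 1)) / ((k : ℝ) + (l : ℝ) + 2)

lemma cc_zero (l : ℕ) : cc 0 l = 0 := by
  have : (l : ℝ) + 2 ≠ 0 := by positivity
  simp only [cc, zero_add, Nat.choose_zero_right, Nat.cast_zero, Nat.cast_one]
  field_simp
  ring

lemma int1 {d : ℝ} (hd : 0 < d) :
    ∫ u in (0:ℝ)..1, u * (1 / (1 + u * d)) = 1 / d - Real.log (1 + d) / d ^ 2 := by
  have := intervalIntegral.integral_eq_sub_of_hasDerivAt (a := 0) (b := 1)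
    (f := fun u => u / d - Real.log (1 + u * d) / d ^ 2) (f' := fun u => u * (1 / (1 + u * d))) ?_ ?_
  · rw [this]; simp
  · intro u hu
    rw [Set.uIcc_of_le zero_le_one] at hu
    have h0 : 0 < 1 + u * d := by have := hu.1; positivity
    have h1 : HasDerivAt (fun u : ℝ => 1 + u * d) d u := by
      simpa using ((hasDerivAt_id u).mul_const d).const_add 1
    have h2 := ((hasDerivAt_id u).div_const d).sub ((h1.log h0.ne').div_const (d ^ 2))
    have h0' : 1 + d * u ≠ 0 := by rw [mul_comm d u]; exact h0.ne'
    refine h2.congr_deriv ?_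
    field_simp
    ring
  · apply ContinuousOn.intervalIntegrable
    rw [Set.uIcc_of_le zero_le_one]
    apply ContinuousOn.mul (by fun_prop)
    apply ContinuousOn.div (by fun_prop) (by fun_prop)
    intro u hu
    have := hu.1; positivity

lemma int2 {Q P : ℝ} (hQ : 0 < Q) (hQP : Q < P) :
    ∫ u in (0:ℝ)..1, u * (1 / ((1 + u * Q) * (1 + u * P) ^ 2)) =
      (Real.log (1 + P) - Real.log (1 + Q)) / (P - Q) ^ 2 - 1 / ((P - Q) * (1 + P)) := by
  have hP : 0 < P := hQ.trans hQP
  have hd : P - Q ≠ 0 := (sub_pos.2 hQP).ne'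
  have := intervalIntegral.integral_eq_sub_of_hasDerivAt (a := 0) (b := 1)
    (f := fun u => (Real.log (1 + u * P) - Real.log (1 + u * Q)) / (P - Q) ^ 2 -
      (u / (1 + u * P)) / (P - Q))
    (f' := fun u => u * (1 / ((1 + u * Q) * (1 + u * P) ^ 2))) ?_ ?_
  · rw [this]; simp; field_simp
  · intro u hu
    rw [Set.uIcc_of_le zero_le_one] at hu
    have h0 : ∀ d : ℝ, 0 < d → 0 < 1 + u * d := by intro d hd; have := hu.1; positivity
    have h1 : ∀ d : ℝ, HasDerivAt (fun u : ℝ => 1 + u * d) d u := by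
      intro d
      simpa using ((hasDerivAt_id u).mul_const d).const_add 1
    have h2 := ((((h1 P).log (h0 P hP).ne').sub ((h1 Q).log (h0 Q hQ).ne')).div_const
      ((P - Q) ^ 2)).sub (((hasDerivAt_id u).div (h1 P) (h0 P hP).ne').div_const (P - Q))
    refine h2.congr_deriv ?_
    have hp := (h0 P hP).ne'
    have hq := (h0 Q hQ).ne'
    have hp' : 1 + P * u ≠ 0 := by rwa [mul_comm P u]
    have hq' : 1 + Q * u ≠ 0 := by rwa [mul_comm Q u]
    have hid : id u = u := rfl
    rw [hid]
    field_simp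
    ring
  · apply ContinuousOn.intervalIntegrable
    rw [Set.uIcc_of_le zero_le_one]
    apply ContinuousOn.mul (by fun_prop)
    apply ContinuousOn.div (by fun_prop) (by fun_prop)
    intro u hu
    have := hu.1; positivity

/-- ∫_0^Q 1/((1+P-x)^2 (1+Q-x)) dx, written on [-Q,0] -/
lemma int3 {Q P : ℝ} (hQ : 0 < Q) (hQP : Q < P) :
    ∫ t in (-Q)..0, 1 / (1 + P + t) ^ 2 * (1 / (1 + Q + t)) =
      (Real.log (1 + Q) - Real.log (1 + P) + Real.log (1 + (P - Q))) / (P - Q) ^ 2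
        + (1 / (1 + P) - 1 / (1 + (P - Q))) / (P - Q) := by
  have hP : 0 < P := hQ.trans hQP
  have hd : P - Q ≠ 0 := (sub_pos.2 hQP).ne'
  have := intervalIntegral.integral_eq_sub_of_hasDerivAt (a := -Q) (b := 0)
    (f := fun t => (Real.log (1 + Q + t) - Real.log (1 + P + t)) / (P - Q) ^ 2 +
      (1 / (1 + P + t)) / (P - Q))
    (f' := fun t => 1 / (1 + P + t) ^ 2 * (1 / (1 + Q + t))) ?_ ?_
  · rw [this]
    have e1 : 1 + Q + -Q = 1 := by ring
    have e2 : 1 + P + -Q = 1 + (P - Q) := by ring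
    simp only [e1, e2, add_zero, Real.log_one]
    ring
  · intro t ht
    rw [Set.uIcc_of_le (by linarith)] at ht
    have hp : (1 + P + t) ≠ 0 := by have := ht.1; linarith
    have hq : (1 + Q + t) ≠ 0 := by have := ht.1; linarith
    have h1 : ∀ d : ℝ, HasDerivAt (fun u : ℝ => 1 + d + u) 1 t := by
      intro d
      exact (hasDerivAt_id t).const_add _
    have h2 := ((((h1 Q).log hq).sub ((h1 P).log hp)).div_const
      ((P - Q) ^ 2)).add (((hasDerivAt_const t (1:ℝ)).div (h1 P) hp).div_const (P - Q))
    refine h2.congr_deriv ?_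
    field_simp
    ring
  · apply ContinuousOn.intervalIntegrable
    rw [Set.uIcc_of_le (by linarith)]
    apply ContinuousOn.mul
    · apply ContinuousOn.div (by fun_prop) (by fun_prop)
      intro u hu
      have := hu.1
      have : 0 < 1 + P + u := by linarith
      positivity
    · apply ContinuousOn.div (by fun_prop) (by fun_prop)
      intro u hu
      have := hu.1
      have : 0 < 1 + Q + u := by linarith
      positivity

lemma int4 {P t : ℝ} (h : -P ≤ t) (s : ℝ) (hts : t ≤ s) :
    ∫ x in t..s, 1 / (1 + P + x) ^ 2 = 1 / (1 + P + t) - 1 / (1 + P + s) := by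
  have := intervalIntegral.integral_eq_sub_of_hasDerivAt (a := t) (b := s)
    (f := fun t => - (1 / (1 + P + t)))
    (f' := fun t => 1 / (1 + P + t) ^ 2) ?_ ?_
  · rw [this]; ring
  · intro x hx
    rw [Set.uIcc_of_le hts] at hx
    have hp : (1 + P + x) ≠ 0 := by have := hx.1; linarith
    have h1 : HasDerivAt (fun u : ℝ => 1 + P + u) 1 x := (hasDerivAt_id x).const_add _
    have h2 := ((hasDerivAt_const x (1:ℝ)).div h1 hp).neg
    refine h2.congr_deriv ?_
    ring
  · apply ContinuousOn.intervalIntegrable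
    rw [Set.uIcc_of_le hts]
    apply ContinuousOn.div (by fun_prop) (by fun_prop)
    intro u hu
    have := hu.1
    have : 0 < 1 + P + u := by linarith
    positivity

lemma hasSum_cc {Q P : ℝ} (hQ : 0 < Q) (hQP : Q < P) (hs : Q + P < 1) :
    HasSum (fun kl : ℕ × ℕ => cc kl.1 kl.2 * Q ^ kl.1 * P ^ kl.2)
      (1 / (1 + P + Q) - (1 / (1 + (P - Q)) -
        ∫ t in (-Q)..0, 1 / (1 + P + t) ^ 2 * (1 / (1 + Q + t)))) := by
  have hP : 0 < P := hQ.trans hQP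
  have hd : 0 < P - Q := sub_pos.2 hQP
  have h1 := hasSum_binom (a := -Q) (c := -P) (by rw [abs_neg, abs_neg, abs_of_pos hQ, abs_of_pos hP]; exact hs)
  have h2 : HasSum (fun kl : ℕ × ℕ => ∫ u in (0:ℝ)..1,
      u * (((kl.1 + kl.2).choose kl.1 : ℝ) * (u * Q) ^ kl.1 * (-(u * P)) ^ kl.2))
      (∫ u in (0:ℝ)..1, u * (1 / (1 + u * (P - Q)))) := by
    apply hasSum_int_aux _ _ (fun kl : ℕ × ℕ => ((kl.1 + kl.2).choose kl.1 : ℝ) * Q ^ kl.1 * P ^ kl.2)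
      zero_le_one
    · intro i; fun_prop
    · exact (hasSum_binom (a := Q) (c := P) (by rw [abs_of_pos hQ, abs_of_pos hP]; exact hs)).summable
    · intro kl x hx0 hx1
      rw [abs_mul, abs_mul, abs_mul, abs_pow, abs_pow, abs_neg, abs_mul, abs_mul, abs_of_pos hQ,
        abs_of_pos hP, abs_of_nonneg hx0, Nat.abs_cast]
      have e1 : (x * Q) ^ kl.1 ≤ Q ^ kl.1 := by gcongr; nlinarith
      have e2 : (x * P) ^ kl.2 ≤ P ^ kl.2 := by gcongr; nlinarith
      calc _ ≤ 1 * (((kl.1 + kl.2).choose kl.1 : ℝ) * Q ^ kl.1 * P ^ kl.2) := by gcongr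
        _ = _ := one_mul _
    · intro x hx0 hx1
      apply HasSum.mul_left
      have := hasSum_binom (a := x * Q) (c := -(x * P)) (by
        rw [abs_neg, abs_of_nonneg (by positivity), abs_of_nonneg (by positivity)]; nlinarith)
      refine hs_congr this (fun _ => rfl) ?_
      congr 1; ring
  have h3 : HasSum (fun kl : ℕ × ℕ => ∫ u in (0:ℝ)..1,
      u * ((-(u * Q)) ^ kl.1 * (((kl.2 : ℝ) + 1) * (-(u * P)) ^ kl.2)))
      (∫ u in (0:ℝ)..1, u * (1 / ((1 + u * Q) * (1 + u * P) ^ 2))) := by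
    apply hasSum_int_aux _ _ (fun kl : ℕ × ℕ => Q ^ kl.1 * (((kl.2 : ℝ) + 1) * P ^ kl.2))
      zero_le_one
    · intro i; fun_prop
    · exact (hasSum_lin (a := Q) (c := P) (by rw [abs_of_pos hQ]; linarith)
        (by rw [abs_of_pos hP]; linarith)).summable
    · intro kl x hx0 hx1
      rw [abs_mul, abs_mul, abs_mul, abs_pow, abs_pow, abs_neg, abs_neg, abs_mul, abs_mul,
        abs_of_pos hQ, abs_of_pos hP, abs_of_nonneg hx0, abs_of_nonneg (by positivity : (0:ℝ) ≤ kl.2 + 1)]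
      have e1 : (x * Q) ^ kl.1 ≤ Q ^ kl.1 := by gcongr; nlinarith
      have e2 : (x * P) ^ kl.2 ≤ P ^ kl.2 := by gcongr; nlinarith
      calc _ ≤ 1 * (Q ^ kl.1 * (((kl.2 : ℝ) + 1) * P ^ kl.2)) := by gcongr
        _ = _ := one_mul _
    · intro x hx0 hx1
      apply HasSum.mul_left
      have := hasSum_lin (a := -(x * Q)) (c := -(x * P))
        (by rw [abs_neg, abs_of_nonneg (by positivity)]; nlinarith)
        (by rw [abs_neg, abs_of_nonneg (by positivity)]; nlinarith)
      simpa only [sub_neg_eq_add] using this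
  have h4 := h1.sub (h2.add h3)
  rw [int1 hd, int2 hQ hQP] at h4
  rw [int3 hQ hQP]
  refine hs_congr h4 ?_ ?_
  · rintro ⟨k, l⟩
    have e1 : ∀ A : ℝ, (∫ u in (0:ℝ)..1, A * u ^ (k + l + 1)) = A / ((k : ℝ) + l + 2) := by
      intro A
      rw [intervalIntegral.integral_const_mul, integral_pow]
      simp only [one_pow, ne_eq, Nat.add_eq_zero_iff, one_ne_zero, and_false, not_false_eq_true,
        zero_pow, sub_zero, Nat.cast_add, Nat.cast_one]
      rw [mul_one_div]; congr 1; ring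
    have e2 : (∫ u in (0:ℝ)..1,
        u * (((k + l).choose k : ℝ) * (u * Q) ^ k * (-(u * P)) ^ l)) =
        (-1) ^ l * ((k + l).choose k : ℝ) * Q ^ k * P ^ l / ((k : ℝ) + l + 2) := by
      rw [← e1]; congr 1; funext u
      rw [neg_pow (u * P)]; ring
    have e3 : (∫ u in (0:ℝ)..1,
        u * ((-(u * Q)) ^ k * (((l : ℝ) + 1) * (-(u * P)) ^ l))) =
        (-1) ^ (k + l) * ((l : ℝ) + 1) * Q ^ k * P ^ l / ((k : ℝ) + l + 2) := by
      rw [← e1]; congr 1; funext u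
      rw [neg_pow (u * P), neg_pow (u * Q)]; ring
    simp only [e2, e3, cc]
    rw [neg_pow Q, neg_pow P]
    ring
  · have hd' := hd.ne'
    have : 1 + (P - Q) ≠ 0 := by positivity
    have e0 : 1 / (P - Q) - 1 / (1 + (P - Q)) / (P - Q) = 1 / (1 + (P - Q)) := by
      field_simp; ring
    have e1 : 1 / ((P - Q) * (1 + P)) = 1 / (1 + P) / (P - Q) := by
      field_simp
    have e2 : 1 - -Q - -P = 1 + P + Q := by ring
    rw [e1, e2]
    linear_combination e0

lemma contOn_of_hasSum (β : ℕ → ℝ) (F : ℝ → ℝ) {Q : ℝ}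
    (hs : Summable (fun k => |β k| * Q ^ k))
    (hF : ∀ x, 0 ≤ x → x ≤ Q → HasSum (fun k => β k * x ^ k) (F x)) :
    ContinuousOn F (Set.Icc 0 Q) := by
  have h : ContinuousOn (fun x => ∑' k, β k * x ^ k) (Set.Icc 0 Q) := by
    apply continuousOn_tsum (u := fun k => |β k| * Q ^ k)
    · intro k; fun_prop
    · exact hs
    · intro k x hx
      rw [Real.norm_eq_abs, abs_mul, abs_pow, abs_of_nonneg hx.1]
      have := hx.1
      have := hx.2
      gcongr
  exact h.congr fun x hx => (hF x hx.1 hx.2).tsum_eq.symm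

section
variable (b : ℕ → ℕ → ℝ) (Bfun : ℝ → ℝ → ℝ)

/-- Row sums: absolute summability and power series of `Bfun · P` -/
lemma row_facts
    (hBfun : ∀ x P : ℝ, Bfun x P = ∑' kl : ℕ × ℕ, b kl.1 kl.2 * x ^ kl.1 * P ^ kl.2)
    (hconv : ∀ x P : ℝ, 0 ≤ x → x < 1 / 2 → x ≤ P → P ≤ 1 / 2 →
      Summable (fun kl : ℕ × ℕ => b kl.1 kl.2 * x ^ kl.1 * P ^ kl.2))
    {Q P : ℝ} (hQ : 0 < Q) (hQ2 : Q < 1 / 2) (hQP : Q ≤ P) (hP : P ≤ 1 / 2) :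
    ∃ β : ℕ → ℝ, (∀ k, HasSum (fun l => b k l * P ^ l) (β k)) ∧
      Summable (fun k => |β k| * Q ^ k) ∧
      ∀ x, 0 ≤ x → x ≤ Q → HasSum (fun k => β k * x ^ k) (Bfun x P) := by
  have hsum : ∀ k, Summable (fun l => b k l * P ^ l) := by
    intro k
    have h := (hconv Q P hQ.le hQ2 hQP hP).prod_factor k
    have h2 := h.mul_left (Q ^ k)⁻¹
    refine h2.congr fun l => ?_
    have : Q ^ k ≠ 0 := by positivity
    field_simp
  have hps : ∀ x, 0 ≤ x → x ≤ Q →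
      HasSum (fun k => (∑' l, b k l * P ^ l) * x ^ k) (Bfun x P) := by
    intro x hx hxQ
    have h := (hconv x P hx (by linarith) (by linarith) hP).hasSum
    rw [← hBfun] at h
    refine h.prod_fiberwise fun k => ?_
    refine hs_congr ((hsum k).hasSum.mul_right (x ^ k)) (fun l => ?_) rfl
    ring
  refine ⟨fun k => ∑' l, b k l * P ^ l, fun k => (hsum k).hasSum, ?_, hps⟩
  refine (hps Q hQ.le le_rfl).summable.abs.congr fun k => ?_
  rw [abs_mul, abs_of_pos (pow_pos hQ k)]

set_option maxHeartbeats 1000000 in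
lemma series_identity
    (hrec : ∀ k ℓ : ℕ, b k ℓ = ((k : ℝ) + 1) *
      ((∑ i ∈ Finset.range k, ∑ j ∈ Finset.range (k - i),
          b i (k - 1 - i - j) * b j ℓ / (((i : ℝ) + 1) * ((i : ℝ) + (j : ℝ) + 2)))
        + (∑ i ∈ Finset.range k, (-1 : ℝ) ^ (k - 1 - i) * b i ℓ / ((i : ℝ) + 1))
        - ((-1 : ℝ) ^ (k + 1 + ℓ) * ((k + 1 + ℓ).choose (k + 1) : ℝ) -
            ((-1 : ℝ) ^ ℓ * ((k + 1 + ℓ).choose (k + 1) : ℝ) +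
              (-1 : ℝ) ^ (k + 1 + ℓ) * ((ℓ : ℝ) + 1)) / ((k : ℝ) + 1 + (ℓ : ℝ) + 2))))
    (hBfun : ∀ x P : ℝ, Bfun x P = ∑' kl : ℕ × ℕ, b kl.1 kl.2 * x ^ kl.1 * P ^ kl.2)
    (hconv : ∀ x P : ℝ, 0 ≤ x → x < 1 / 2 → x ≤ P → P ≤ 1 / 2 →
      Summable (fun kl : ℕ × ℕ => b kl.1 kl.2 * x ^ kl.1 * P ^ kl.2))
    {Q P : ℝ} (hQ : 0 < Q) (hQP : Q < P) (hP : P ≤ 1 / 2) :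
    ∫ t in (0:ℝ)..Q, Bfun t P * (1 / (1 + Q) - ∫ s in (0:ℝ)..t, Bfun s Q) =
      1 / (1 + (P - Q)) - (∫ t in (-Q)..0, 1 / (1 + P + t) ^ 2 * (1 / (1 + Q + t)))
        - 1 / (1 + P + Q) := by
  have hQ2 : Q < 1 / 2 := by linarith
  obtain ⟨β, hβ, hβs, hβB⟩ := row_facts b Bfun hBfun hconv hQ hQ2 hQP.le hP
  obtain ⟨α, hα, hαs, hαB⟩ := row_facts b Bfun hBfun hconv hQ hQ2 le_rfl hQ2.le
  -- continuity
  have cP := contOn_of_hasSum β (fun x => Bfun x P) hβs hβB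
  have cQ := contOn_of_hasSum α (fun x => Bfun x Q) hαs hαB
  have cΦ : ContinuousOn (fun t => ∫ s in (0:ℝ)..t, Bfun s Q) (Set.Icc 0 Q) := by
    have := intervalIntegral.continuousOn_primitive_interval (μ := volume) (f := fun x => Bfun x Q)
      (a := 0) (b := Q) (by rw [Set.uIcc_of_le hQ.le]; exact cQ.integrableOn_Icc)
    rwa [Set.uIcc_of_le hQ.le] at this
  set Φ : ℝ → ℝ := fun t => ∫ s in (0:ℝ)..t, Bfun s Q with hΦ
  set ψ : ℝ := ∫ t in (0:ℝ)..Q, Bfun t P with hψ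
  set X : ℝ := ∫ t in (0:ℝ)..Q, Bfun t P * Φ t with hX
  have hsplit : ∫ t in (0:ℝ)..Q, Bfun t P * (1 / (1 + Q) - Φ t) = 1 / (1 + Q) * ψ - X := by
    rw [hψ, hX, ← intervalIntegral.integral_const_mul, ← intervalIntegral.integral_sub]
    · congr 1; funext t; ring
    · apply ContinuousOn.intervalIntegrable
      rw [Set.uIcc_of_le hQ.le]
      exact continuousOn_const.mul cP
    · apply ContinuousOn.intervalIntegrable
      rw [Set.uIcc_of_le hQ.le]
      exact cP.mul cΦ
  change ∫ t in (0:ℝ)..Q, Bfun t P * (1 / (1 + Q) - Φ t) = _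
  rw [hsplit]
  -- ψ as a series
  have hψs : HasSum (fun k => β k * Q ^ (k + 1) / ((k : ℝ) + 1)) ψ := by
    have := hasSum_int_aux (fun k x => β k * x ^ k) (fun x => Bfun x P) (fun k => |β k| * Q ^ k)
      hQ.le (fun k => by fun_prop) hβs (fun k x hx hxQ => by
        rw [abs_mul, abs_pow, abs_of_nonneg hx]; gcongr) hβB
    refine hs_congr this (fun k => ?_) rfl
    rw [intervalIntegral.integral_const_mul, integral_pow]
    simp; ring
  -- Φ as a series
  have hbQ : Summable (fun im : ℕ × ℕ => |b im.1 im.2| * Q ^ im.1 * Q ^ im.2) := by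
    refine (hconv Q Q hQ.le hQ2 le_rfl hQ2.le).abs.congr fun k => ?_
    rw [abs_mul, abs_mul, abs_of_pos (pow_pos hQ _), abs_of_pos (pow_pos hQ _)]
  have hΦs : ∀ t, 0 ≤ t → t ≤ Q →
      HasSum (fun im : ℕ × ℕ => b im.1 im.2 * Q ^ im.2 * (t ^ (im.1 + 1) / ((im.1 : ℝ) + 1)))
        (Φ t) := by
    intro t ht htQ
    have := hasSum_int_aux (fun (im : ℕ × ℕ) x => b im.1 im.2 * x ^ im.1 * Q ^ im.2)
      (fun x => Bfun x Q) (fun im => |b im.1 im.2| * Q ^ im.1 * Q ^ im.2)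
      ht (fun k => by fun_prop) hbQ (fun im x hx hxt => by
        have : x ≤ Q := hxt.trans htQ
        rw [abs_mul, abs_mul, abs_pow, abs_of_nonneg hx, abs_of_pos (pow_pos hQ _)]; gcongr)
        (fun x hx hxt => by
          rw [hBfun]
          exact (hconv x Q hx (by linarith) (by linarith) hQ2.le).hasSum)
    refine hs_congr this (fun k => ?_) rfl
    rw [intervalIntegral.integral_mul_const, intervalIntegral.integral_const_mul, integral_pow]
    simp; ring
  -- X as a series
  have hXs : HasSum (fun q : ℕ × (ℕ × ℕ) => β q.1 * (b q.2.1 q.2.2) *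
      Q ^ (q.2.1 + q.1 + q.2.2 + 2) / (((q.2.1 : ℝ) + 1) * ((q.2.1 : ℝ) + q.1 + 2))) X := by
    have := hasSum_int_aux (fun (q : ℕ × (ℕ × ℕ)) t => (β q.1 * t ^ q.1) *
        (b q.2.1 q.2.2 * Q ^ q.2.2 * (t ^ (q.2.1 + 1) / ((q.2.1 : ℝ) + 1))))
      (fun t => Bfun t P * Φ t)
      (fun q => (|β q.1| * Q ^ q.1) * ((|b q.2.1 q.2.2| * Q ^ q.2.1 * Q ^ q.2.2) * Q))
      hQ.le (fun q => ((continuous_const.mul (continuous_pow _)).mul (continuous_const.mul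
        ((continuous_pow _).div_const _))))
      (by
        have h1 := hbQ.mul_right Q
        exact summable_mul_of_summable_norm hβs.norm h1.norm)
      (fun q t ht htQ => by
        rw [abs_mul, abs_mul, abs_mul, abs_mul, abs_div, abs_pow, abs_pow, abs_pow,
          abs_of_nonneg ht, abs_of_pos hQ, abs_of_pos (by positivity : (0:ℝ) < (q.2.1:ℝ) + 1)]
        have e : t ^ (q.2.1 + 1) / ((q.2.1 : ℝ) + 1) ≤ Q ^ (q.2.1 + 1) := by
          calc t ^ (q.2.1 + 1) / ((q.2.1 : ℝ) + 1) ≤ t ^ (q.2.1 + 1) :=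
                div_le_self (by positivity) (by linarith [(Nat.cast_nonneg q.2.1 : (0:ℝ) ≤ q.2.1)])
            _ ≤ _ := by gcongr
        calc _ ≤ (|β q.1| * Q ^ q.1) * (|b q.2.1 q.2.2| * Q ^ q.2.2 * Q ^ (q.2.1 + 1)) := by gcongr
          _ = _ := by ring)
      (fun t ht htQ => by
        have h1 := hβB t ht htQ
        have h2 := hΦs t ht htQ
        exact h1.mul h2 (summable_mul_of_summable_norm h1.summable.norm h2.summable.norm))
    refine hs_congr this (fun q => ?_) rfl
    obtain ⟨j, i, m⟩ := q
    have e : ∀ t : ℝ, (β j * t ^ j) * (b i m * Q ^ m * (t ^ (i + 1) / ((i : ℝ) + 1))) =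
        (β j * (b i m) * Q ^ m / ((i : ℝ) + 1)) * t ^ (i + j + 1) := by
      intro t; ring
    simp only [e]
    rw [intervalIntegral.integral_const_mul, integral_pow]
    have h0 : (0:ℝ) ^ (i + j + 1 + 1) = 0 := by simp
    rw [h0]
    push_cast
    have h1 : (i : ℝ) + 1 ≠ 0 := by positivity
    have h2 : (i : ℝ) + j + 2 ≠ 0 := by positivity
    have h3 : (i : ℝ) + j + 1 + 1 = i + j + 2 := by ring
    rw [h3]
    field_simp
    ring
  have hXs3 : HasSum (fun k => ∑ i ∈ Finset.range (k + 1), ∑ j ∈ Finset.range (k + 1 - i),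
      β j * b i (k - i - j) * Q ^ (k + 2) / (((i : ℝ) + 1) * ((i : ℝ) + j + 2))) X := by
    let e : ℕ × ℕ × ℕ ≃ ℕ × (ℕ × ℕ) :=
      ⟨fun x => (x.2.1, x.1, x.2.2), fun x => (x.2.1, x.1, x.2.2), fun _ => rfl, fun _ => rfl⟩
    have := hasSum_regroup3 (e.hasSum_iff.2 hXs)
    refine hs_congr this (fun k => ?_) rfl
    refine Finset.sum_congr rfl fun i hi => Finset.sum_congr rfl fun j hj => ?_
    have hi := Finset.mem_range.1 hi
    have hj := Finset.mem_range.1 hj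
    have : i + j + (k - i - j) + 2 = k + 2 := by omega
    simp [e, this]
  have hYs : HasSum (fun k => ∑ i ∈ Finset.range (k + 1),
      (-1) ^ (k - i) * β i * Q ^ (k + 2) / ((i : ℝ) + 1)) (ψ * (Q / (1 + Q))) := by
    have hg : HasSum (fun r : ℕ => Q * (-Q) ^ r) (Q / (1 + Q)) := by
      have := (hasSum_geometric_of_norm_lt_one (ξ := -Q)
        (by rw [norm_neg, Real.norm_eq_abs, abs_of_pos hQ]; linarith)).mul_left Q
      refine hs_congr this (fun _ => rfl) ?_
      rw [sub_neg_eq_add]; rfl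
    have h := hψs.mul hg (summable_mul_of_summable_norm hψs.summable.norm hg.summable.norm)
    refine hs_congr (hasSum_regroup2 h) (fun k => ?_) rfl
    refine Finset.sum_congr rfl fun i hi => ?_
    have hi := Finset.mem_range.1 hi
    obtain ⟨r, rfl⟩ : ∃ r, k = i + r := ⟨k - i, by omega⟩
    simp only [Nat.add_sub_cancel_left]
    rw [neg_pow Q]; ring
  -- the c part
  have hC := hasSum_cc hQ hQP (by linarith)
  set C := 1 / (1 + P + Q) - (1 / (1 + (P - Q)) -
        ∫ t in (-Q)..0, 1 / (1 + P + t) ^ 2 * (1 / (1 + Q + t))) with hCdef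
  have hγ : ∀ k, Summable (fun l => cc k l * P ^ l) := by
    intro k
    have h2 := (hC.summable.prod_factor k).mul_left (Q ^ k)⁻¹
    refine h2.congr fun l => ?_
    have : Q ^ k ≠ 0 := by positivity
    field_simp
  set γ : ℕ → ℝ := fun k => ∑' l, cc k l * P ^ l with hγdef
  have hγC : HasSum (fun k => γ k * Q ^ k) C := by
    refine hC.prod_fiberwise fun k => ?_
    refine hs_congr ((hγ k).hasSum.mul_right (Q ^ k)) (fun l => ?_) rfl
    ring
  have hγC' : HasSum (fun k => γ (k + 1) * Q ^ (k + 1)) C := by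
    have h := (hasSum_nat_add_iff' (f := fun k => γ k * Q ^ k) 1).2 hγC
    refine hs_congr h (fun _ => rfl) ?_
    simp [hγdef, cc_zero]
  -- recursion for β
  have hβrec : ∀ k, β k = ((k : ℝ) + 1) *
      ((∑ i ∈ Finset.range k, ∑ j ∈ Finset.range (k - i),
          b i (k - 1 - i - j) * β j / (((i : ℝ) + 1) * ((i : ℝ) + (j : ℝ) + 2)))
        + (∑ i ∈ Finset.range k, (-1 : ℝ) ^ (k - 1 - i) * β i / ((i : ℝ) + 1))
        - γ (k + 1)) := by
    intro k
    refine (hβ k).unique ?_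
    have h1 : HasSum (fun l => ∑ i ∈ Finset.range k, ∑ j ∈ Finset.range (k - i),
          b i (k - 1 - i - j) * (b j l * P ^ l) / (((i : ℝ) + 1) * ((i : ℝ) + (j : ℝ) + 2)))
        (∑ i ∈ Finset.range k, ∑ j ∈ Finset.range (k - i),
          b i (k - 1 - i - j) * β j / (((i : ℝ) + 1) * ((i : ℝ) + (j : ℝ) + 2))) :=
      hasSum_sum fun i _ => hasSum_sum fun j _ => ((hβ j).mul_left _).div_const _
    have h2 : HasSum (fun l => ∑ i ∈ Finset.range k,
          (-1 : ℝ) ^ (k - 1 - i) * (b i l * P ^ l) / ((i : ℝ) + 1))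
        (∑ i ∈ Finset.range k, (-1 : ℝ) ^ (k - 1 - i) * β i / ((i : ℝ) + 1)) :=
      hasSum_sum fun i _ => ((hβ i).mul_left _).div_const _
    refine hs_congr (((h1.add h2).sub (hγ (k + 1)).hasSum).mul_left ((k : ℝ) + 1))
      (fun l => ?_) rfl
    rw [hrec k l, mul_assoc]
    congr 1
    rw [sub_mul, add_mul, Finset.sum_mul, Finset.sum_mul]
    congr 1
    · congr 1
      · refine Finset.sum_congr rfl fun i _ => ?_
        rw [Finset.sum_mul]
        refine Finset.sum_congr rfl fun j _ => ?_
        ring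
      · refine Finset.sum_congr rfl fun i _ => ?_
        ring
    · simp only [cc]
      push_cast
      ring
  -- shift
  have hXs' : HasSum (fun k => (∑ i ∈ Finset.range k, ∑ j ∈ Finset.range (k - i),
          b i (k - 1 - i - j) * β j / (((i : ℝ) + 1) * ((i : ℝ) + (j : ℝ) + 2))) * Q ^ (k + 1)) X := by
    rw [← hasSum_nat_add_iff' 1]
    refine hs_congr hXs3 (fun k => ?_) (by simp)
    rw [Finset.sum_mul]
    refine Finset.sum_congr rfl fun i _ => ?_
    rw [Finset.sum_mul]
    refine Finset.sum_congr rfl fun j _ => ?_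
    rw [Nat.add_sub_cancel]
    ring
  have hYs' : HasSum (fun k => (∑ i ∈ Finset.range k,
      (-1 : ℝ) ^ (k - 1 - i) * β i / ((i : ℝ) + 1)) * Q ^ (k + 1)) (ψ * (Q / (1 + Q))) := by
    rw [← hasSum_nat_add_iff' 1]
    refine hs_congr hYs (fun k => ?_) (by simp)
    rw [Finset.sum_mul]
    refine Finset.sum_congr rfl fun i _ => ?_
    rw [Nat.add_sub_cancel]
    ring
  have hfin : ψ = X + ψ * (Q / (1 + Q)) - C := by
    refine hψs.unique ?_
    refine hs_congr ((hXs'.add hYs').sub hγC') (fun k => ?_) rfl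
    rw [hβrec k]
    have : (k : ℝ) + 1 ≠ 0 := by positivity
    generalize (∑ i ∈ Finset.range k, ∑ j ∈ Finset.range (k - i),
          b i (k - 1 - i - j) * β j / (((i : ℝ) + 1) * ((i : ℝ) + (j : ℝ) + 2))) = u
    generalize (∑ i ∈ Finset.range k, (-1 : ℝ) ^ (k - 1 - i) * β i / ((i : ℝ) + 1)) = v
    field_simp
  have h1Q : 1 + Q ≠ 0 := by positivity
  have e1 : 1 / (1 + Q) * ψ = ψ - ψ * (Q / (1 + Q)) := by field_simp; ring
  rw [e1]
  rw [hCdef] at hfin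
  linarith
end

lemma lint_Ioc {f : ℝ → ℝ} {g : ℝ → ENNReal} {a c : ℝ} (hac : a ≤ c)
    (hi : IntervalIntegrable f volume a c) (hn : ∀ x, a < x → x < c → 0 ≤ f x)
    (hg : ∀ x, a < x → x < c → g x = ENNReal.ofReal (f x)) :
    ∫⁻ t in Set.Ioc a c, g t = ENNReal.ofReal (∫ t in a..c, f t) := by
  rw [intervalIntegral.integral_of_le hac, ← Measure.restrict_congr_set Ioo_ae_eq_Ioc,
    setLIntegral_congr_fun measurableSet_Ioo (g := fun x => ENNReal.ofReal (f x))
      (fun x hx => hg x hx.1 hx.2),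
    ofReal_integral_eq_lintegral_ofReal]
  · rw [intervalIntegrable_iff_integrableOn_Ioc_of_le hac] at hi
    exact hi.mono_set Set.Ioo_subset_Ioc_self
  · exact (ae_restrict_mem measurableSet_Ioo).mono fun x hx => hn x hx.1 hx.2

section
variable (B : ℝ → ℝ → ℝ)

noncomputable def atomW (P : ℝ) : ℝ := Real.sqrt ((1 - 2 * P) / (1 + 2 * P))

lemma atomW_nonneg (P : ℝ) : 0 ≤ atomW P := Real.sqrt_nonneg _

noncomputable def hiM (P : ℝ) : Measure ℝ :=
  (volume.restrict (Set.Ioc (-P) 0)).withDensity (fun t => ENNReal.ofReal (1 / (1 + P + t) ^ 2))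
  + (volume.restrict (Set.Ioc 0 P)).withDensity (fun t => ENNReal.ofReal (B t P))
  + ENNReal.ofReal (atomW P) • Measure.dirac P

lemma hiM_apply {P : ℝ} {S : Set ℝ} (hS : MeasurableSet S) :
    hiM B P S = (∫⁻ t in S ∩ Set.Ioc (-P) 0, ENNReal.ofReal (1 / (1 + P + t) ^ 2))
      + (∫⁻ t in S ∩ Set.Ioc 0 P, ENNReal.ofReal (B t P))
      + ENNReal.ofReal (atomW P) * S.indicator 1 P := by
  simp only [hiM, Measure.add_apply, Measure.smul_apply, smul_eq_mul]
  rw [withDensity_apply _ hS, withDensity_apply _ hS, Measure.restrict_restrict hS,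
    Measure.restrict_restrict hS, Measure.dirac_apply' _ hS]

lemma hiM_singleton {P t : ℝ} (h : t ≠ P) : hiM B P {t} = 0 := by
  rw [hiM_apply B (measurableSet_singleton t)]
  have h1 : ∀ s : Set ℝ, volume.restrict ({t} ∩ s) = 0 := by
    intro s
    rw [Measure.restrict_eq_zero]
    exact measure_mono_null Set.inter_subset_left (by simp)
  simp [h1, h.symm]

lemma ii4 {P t s : ℝ} (h : -P ≤ t) (hts : t ≤ s) :
    IntervalIntegrable (fun x => 1 / (1 + P + x) ^ 2) volume t s := by
  apply ContinuousOn.intervalIntegrable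
  rw [Set.uIcc_of_le hts]
  apply ContinuousOn.div (by fun_prop) (by fun_prop)
  intro u hu
  have := hu.1
  have : 0 < 1 + P + u := by linarith
  positivity

lemma hiM_int
    (hint : ∀ P : ℝ, 0 ≤ P → P ≤ 1 / 2 →
      ∫ x in (0 : ℝ)..P, B x P = 1 / (P + 1) - Real.sqrt ((1 - 2 * P) / (1 + 2 * P)))
    {P : ℝ} (hP : 0 < P) (hP2 : P ≤ 1 / 2) :
    IntervalIntegrable (fun x => B x P) volume 0 P := by
  by_contra hc
  have h := hint P hP.le hP2
  rw [intervalIntegral.integral_undef hc] at h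
  have h1 : Real.sqrt ((1 - 2 * P) / (1 + 2 * P)) < 1 / (P + 1) := by
    rw [Real.sqrt_lt' (by positivity), div_pow, one_pow, div_lt_div_iff₀ (by positivity) (by positivity)]
    nlinarith [mul_pos hP hP, mul_pos (mul_pos hP hP) hP]
  linarith

lemma hiM_int'
    (hint : ∀ P : ℝ, 0 ≤ P → P ≤ 1 / 2 →
      ∫ x in (0 : ℝ)..P, B x P = 1 / (P + 1) - Real.sqrt ((1 - 2 * P) / (1 + 2 * P)))
    {P a c : ℝ} (ha : 0 ≤ a) (hac : a ≤ c) (hc : c ≤ P) (hP : 0 < P) (hP2 : P ≤ 1 / 2) :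
    IntervalIntegrable (fun x => B x P) volume a c := by
  refine (hiM_int B hint hP hP2).mono_set ?_
  rw [Set.uIcc_of_le hac, Set.uIcc_of_le hP.le]
  exact Set.Icc_subset_Icc ha hc

lemma B_nonneg
    (hpos : ∀ x P : ℝ, 0 ≤ x → x < 1 / 2 → x ≤ P → P ≤ 1 / 2 → 0 ≤ B x P)
    {P x : ℝ} (hP2 : P ≤ 1 / 2) (hx : 0 < x) (hxP : x < P) :
    0 ≤ B x P := hpos x P hx.le (by linarith) hxP.le hP2

lemma tail_eq
    (hpos : ∀ x P : ℝ, 0 ≤ x → x < 1 / 2 → x ≤ P → P ≤ 1 / 2 → 0 ≤ B x P)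
    (hint : ∀ P : ℝ, 0 ≤ P → P ≤ 1 / 2 →
      ∫ x in (0 : ℝ)..P, B x P = 1 / (P + 1) - Real.sqrt ((1 - 2 * P) / (1 + 2 * P)))
    {P t : ℝ} (ht : 0 ≤ t) (htP : t ≤ P) (hP : 0 < P) (hP2 : P ≤ 1 / 2) :
    1 / (1 + P) - ∫ s in (0:ℝ)..t, B s P = (∫ s in t..P, B s P) + atomW P ∧
      0 ≤ ∫ s in t..P, B s P := by
  constructor
  · have h := hint P hP.le hP2
    have h2 := intervalIntegral.integral_add_adjacent_intervals
      (hiM_int' B hint le_rfl ht htP hP hP2) (hiM_int' B hint ht htP le_rfl hP hP2)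
    rw [atomW, add_comm 1 P]
    linarith
  · rw [intervalIntegral.integral_of_le htP, ← Measure.restrict_congr_set Ioo_ae_eq_Ioc]
    refine setIntegral_nonneg measurableSet_Ioo fun x hx => ?_
    exact B_nonneg B hpos hP2 (ht.trans_lt hx.1) hx.2

lemma hiM_Ioi_pos
    (hpos : ∀ x P : ℝ, 0 ≤ x → x < 1 / 2 → x ≤ P → P ≤ 1 / 2 → 0 ≤ B x P)
    (hint : ∀ P : ℝ, 0 ≤ P → P ≤ 1 / 2 →
      ∫ x in (0 : ℝ)..P, B x P = 1 / (P + 1) - Real.sqrt ((1 - 2 * P) / (1 + 2 * P)))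
    {P t : ℝ} (ht : 0 ≤ t) (htP : t < P) (hP2 : P ≤ 1 / 2) :
    hiM B P (Set.Ioi t) = ENNReal.ofReal (1 / (1 + P) - ∫ s in (0:ℝ)..t, B s P) := by
  have hP : 0 < P := ht.trans_lt htP
  obtain ⟨h1, h2⟩ := tail_eq B hpos hint ht htP.le hP hP2
  rw [h1, ENNReal.ofReal_add h2 (atomW_nonneg _), hiM_apply B measurableSet_Ioi,
    Set.inter_comm, Set.Ioc_inter_Ioi, Set.inter_comm, Set.Ioc_inter_Ioi,
    sup_eq_right.2 ht, sup_eq_right.2 (by linarith : -P ≤ t), Set.Ioc_eq_empty (not_lt.2 ht),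
    lint_Ioc htP.le (hiM_int' B hint ht htP.le le_rfl hP hP2)
      (fun x h1 h2 => B_nonneg B hpos hP2 (ht.trans_lt h1) h2) (fun _ _ _ => rfl)]
  simp [htP]

lemma hiM_pos_part
    (hpos : ∀ x P : ℝ, 0 ≤ x → x < 1 / 2 → x ≤ P → P ≤ 1 / 2 → 0 ≤ B x P)
    (hint : ∀ P : ℝ, 0 ≤ P → P ≤ 1 / 2 →
      ∫ x in (0 : ℝ)..P, B x P = 1 / (P + 1) - Real.sqrt ((1 - 2 * P) / (1 + 2 * P)))
    {P : ℝ} (hP : 0 < P) (hP2 : P ≤ 1 / 2) :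
    ENNReal.ofReal (1 / (1 + P)) =
    (∫⁻ t in Set.Ioc 0 P, ENNReal.ofReal (B t P)) + ENNReal.ofReal (atomW P) := by
  obtain ⟨h1, h2⟩ := tail_eq B hpos hint le_rfl hP.le hP hP2
  rw [intervalIntegral.integral_same, sub_zero] at h1
  rw [lint_Ioc hP.le (hiM_int B hint hP hP2)
      (fun x h1 h2 => B_nonneg B hpos hP2 h1 h2) (fun _ _ _ => rfl), h1,
      ENNReal.ofReal_add h2 (atomW_nonneg _)]

lemma neg_part {P t s : ℝ} (ht : -P ≤ t) (hts : t ≤ s) :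
    (∫⁻ x in Set.Ioc t s, ENNReal.ofReal (1 / (1 + P + x) ^ 2)) =
      ENNReal.ofReal (1 / (1 + P + t) - 1 / (1 + P + s)) := by
  rw [lint_Ioc hts (ii4 ht hts) (fun x _ _ => by positivity) (fun _ _ _ => rfl), int4 ht s hts]

lemma hiM_Ioi_neg
    (hpos : ∀ x P : ℝ, 0 ≤ x → x < 1 / 2 → x ≤ P → P ≤ 1 / 2 → 0 ≤ B x P)
    (hint : ∀ P : ℝ, 0 ≤ P → P ≤ 1 / 2 →
      ∫ x in (0 : ℝ)..P, B x P = 1 / (P + 1) - Real.sqrt ((1 - 2 * P) / (1 + 2 * P)))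
    {P t : ℝ} (ht : -P ≤ t) (ht0 : t ≤ 0) (hP : 0 < P) (hP2 : P ≤ 1 / 2) :
    hiM B P (Set.Ioi t) = ENNReal.ofReal (1 / (1 + P + t)) := by
  rw [hiM_apply B measurableSet_Ioi,
    Set.inter_comm, Set.Ioc_inter_Ioi, Set.inter_comm, Set.Ioc_inter_Ioi,
    sup_eq_left.2 ht0, sup_eq_right.2 ht, neg_part ht ht0]
  have : P ∈ Set.Ioi t := ht0.trans_lt hP
  rw [Set.indicator_of_mem this, Pi.one_apply, mul_one, add_assoc,
    ← hiM_pos_part B hpos hint hP hP2, ← ENNReal.ofReal_add]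
  · congr 1; simp
  · rw [sub_nonneg]
    apply one_div_le_one_div_of_le <;> linarith
  · positivity

lemma hiM_univ
    (hpos : ∀ x P : ℝ, 0 ≤ x → x < 1 / 2 → x ≤ P → P ≤ 1 / 2 → 0 ≤ B x P)
    (hint : ∀ P : ℝ, 0 ≤ P → P ≤ 1 / 2 →
      ∫ x in (0 : ℝ)..P, B x P = 1 / (P + 1) - Real.sqrt ((1 - 2 * P) / (1 + 2 * P)))
    {P : ℝ} (hP : 0 < P) (hP2 : P ≤ 1 / 2) : hiM B P Set.univ = 1 := by
  rw [hiM_apply B MeasurableSet.univ, Set.univ_inter, Set.univ_inter,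
    neg_part le_rfl (by linarith : -P ≤ 0)]
  rw [Set.indicator_of_mem (Set.mem_univ _), Pi.one_apply, mul_one, add_assoc,
    ← hiM_pos_part B hpos hint hP hP2, ← ENNReal.ofReal_add]
  · simp
  · rw [sub_nonneg]
    apply one_div_le_one_div_of_le <;> linarith
  · positivity

lemma hiM_Ioi_low
    (hpos : ∀ x P : ℝ, 0 ≤ x → x < 1 / 2 → x ≤ P → P ≤ 1 / 2 → 0 ≤ B x P)
    (hint : ∀ P : ℝ, 0 ≤ P → P ≤ 1 / 2 →
      ∫ x in (0 : ℝ)..P, B x P = 1 / (P + 1) - Real.sqrt ((1 - 2 * P) / (1 + 2 * P)))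
    {P t : ℝ} (ht : t ≤ -P) (hP : 0 < P) (hP2 : P ≤ 1 / 2) :
    hiM B P (Set.Ioi t) = 1 := by
  apply le_antisymm
  · rw [← hiM_univ B hpos hint hP hP2]; exact measure_mono (Set.subset_univ _)
  · calc (1 : ENNReal) = hiM B P (Set.Ioi (-P)) := by
          rw [hiM_Ioi_neg B hpos hint le_rfl (by linarith) hP hP2]; simp
      _ ≤ _ := measure_mono (Set.Ioi_subset_Ioi ht)

lemma hiM_Ioi_high {P t : ℝ} (ht : P ≤ t) (hP : 0 < P) :
    hiM B P (Set.Ioi t) = 0 := by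
  rw [hiM_apply B measurableSet_Ioi,
    Set.inter_comm, Set.Ioc_inter_Ioi, Set.inter_comm, Set.Ioc_inter_Ioi,
    sup_eq_right.2 (by linarith : 0 ≤ t), sup_eq_right.2 (by linarith : -P ≤ t),
    Set.Ioc_eq_empty (not_lt.2 (by linarith)), Set.Ioc_eq_empty (not_lt.2 ht)]
  simp [not_lt.2 ht]

lemma lintegral_hiM
    (hint : ∀ P : ℝ, 0 ≤ P → P ≤ 1 / 2 →
      ∫ x in (0 : ℝ)..P, B x P = 1 / (P + 1) - Real.sqrt ((1 - 2 * P) / (1 + 2 * P)))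
    {P : ℝ} (hP : 0 < P) (hP2 : P ≤ 1 / 2) {G : ℝ → ENNReal} (hG : Measurable G) :
    ∫⁻ t, G t ∂(hiM B P) = (∫⁻ t in Set.Ioc (-P) 0, ENNReal.ofReal (1 / (1 + P + t) ^ 2) * G t)
      + (∫⁻ t in Set.Ioc 0 P, ENNReal.ofReal (B t P) * G t)
      + ENNReal.ofReal (atomW P) * G P := by
  have hB : AEMeasurable (fun t => ENNReal.ofReal (B t P)) (volume.restrict (Set.Ioc 0 P)) := by
    have := hiM_int B hint hP hP2
    rw [intervalIntegrable_iff_integrableOn_Ioc_of_le hP.le] at this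
    exact this.aestronglyMeasurable.aemeasurable.ennreal_ofReal
  rw [hiM, lintegral_add_measure, lintegral_add_measure, lintegral_smul_measure,
    lintegral_dirac' _ hG, lintegral_withDensity_eq_lintegral_mul₀ (by fun_prop) hG.aemeasurable,
    lintegral_withDensity_eq_lintegral_mul₀ hB hG.aemeasurable]
  rfl

lemma hiM_prod
    (hpos : ∀ x P : ℝ, 0 ≤ x → x < 1 / 2 → x ≤ P → P ≤ 1 / 2 → 0 ≤ B x P)
    (hint : ∀ P : ℝ, 0 ≤ P → P ≤ 1 / 2 →
      ∫ x in (0 : ℝ)..P, B x P = 1 / (P + 1) - Real.sqrt ((1 - 2 * P) / (1 + 2 * P)))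
    {Q P : ℝ} (hQ : 0 < Q) (hQP : Q < P) (hP2 : P ≤ 1 / 2)
    (hser : ∫ t in (0:ℝ)..Q, B t P * (1 / (1 + Q) - ∫ s in (0:ℝ)..t, B s Q) =
      1 / (1 + (P - Q)) - (∫ t in (-Q)..0, 1 / (1 + P + t) ^ 2 * (1 / (1 + Q + t)))
        - 1 / (1 + P + Q)) :
    ∫⁻ t, hiM B Q (Set.Ioi t) ∂(hiM B P) = ENNReal.ofReal (1 - 1 / (1 + P + Q)) := by
  have hP : 0 < P := hQ.trans hQP
  have hQ2 : Q ≤ 1 / 2 := by linarith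
  have hG : Measurable (fun t => hiM B Q (Set.Ioi t)) :=
    Antitone.measurable fun x y hxy => measure_mono (Set.Ioi_subset_Ioi hxy)
  rw [lintegral_hiM B hint hP hP2 hG, hiM_Ioi_high B hQP.le hQ, mul_zero, add_zero]
  rw [← Set.Ioc_union_Ioc_eq_Ioc (by linarith : -P ≤ -Q) (by linarith : -Q ≤ 0),
    lintegral_union measurableSet_Ioc (Set.Ioc_disjoint_Ioc_of_le le_rfl),
    ← Set.Ioc_union_Ioc_eq_Ioc hQ.le hQP.le,
    lintegral_union measurableSet_Ioc (Set.Ioc_disjoint_Ioc_of_le le_rfl)]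
  have i1 : ∫⁻ t in Set.Ioc (-P) (-Q), ENNReal.ofReal (1 / (1 + P + t) ^ 2) * hiM B Q (Set.Ioi t)
      = ENNReal.ofReal (1 - 1 / (1 + (P - Q))) := by
    rw [setLIntegral_congr_fun measurableSet_Ioc
      (g := fun t => ENNReal.ofReal (1 / (1 + P + t) ^ 2))
      (fun x hx => by rw [hiM_Ioi_low B hpos hint hx.2 hQ hQ2, mul_one]),
      neg_part le_rfl (by linarith)]
    congr 2
    · simp
    · congr 1; ring
  have n2 : 0 ≤ ∫ t in (-Q)..0, 1 / (1 + P + t) ^ 2 * (1 / (1 + Q + t)) := by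
    apply intervalIntegral.integral_nonneg (by linarith)
    intro u hu
    have : 0 < 1 + Q + u := by linarith [hu.1]
    positivity
  have i2 : ∫⁻ t in Set.Ioc (-Q) 0, ENNReal.ofReal (1 / (1 + P + t) ^ 2) * hiM B Q (Set.Ioi t)
      = ENNReal.ofReal (∫ t in (-Q)..0, 1 / (1 + P + t) ^ 2 * (1 / (1 + Q + t))) := by
    apply lint_Ioc (by linarith)
    · apply (ii4 (by linarith) (by linarith)).mul_continuousOn
      rw [Set.uIcc_of_le (by linarith)]
      apply ContinuousOn.div (by fun_prop) (by fun_prop)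
      intro u hu
      have : 0 < 1 + Q + u := by linarith [hu.1]
      positivity
    · intro u hu _
      have : 0 < 1 + Q + u := by linarith
      positivity
    · intro u hu hu2
      rw [hiM_Ioi_neg B hpos hint hu.le hu2.le hQ hQ2, ENNReal.ofReal_mul (by positivity)]
  have nn : ∀ x, 0 < x → x < Q → 0 ≤ 1 / (1 + Q) - ∫ s in (0:ℝ)..x, B s Q := by
    intro x hx hxQ
    obtain ⟨h1, h2⟩ := tail_eq B hpos hint hx.le hxQ.le hQ hQ2
    rw [h1]
    exact add_nonneg h2 (atomW_nonneg _)
  have nB : ∀ x, 0 < x → x < Q → 0 ≤ B x P := fun x hx hxQ =>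
    B_nonneg B hpos hP2 hx (hxQ.trans hQP)
  have i3 : ∫⁻ t in Set.Ioc 0 Q, ENNReal.ofReal (B t P) * hiM B Q (Set.Ioi t)
      = ENNReal.ofReal (∫ t in (0:ℝ)..Q, B t P * (1 / (1 + Q) - ∫ s in (0:ℝ)..t, B s Q)) := by
    apply lint_Ioc hQ.le
    · apply (hiM_int' B hint le_rfl hQ.le hQP.le hP hP2).mul_continuousOn
      apply continuousOn_const.sub
      apply intervalIntegral.continuousOn_primitive_interval
      rw [Set.uIcc_of_le hQ.le, integrableOn_Icc_iff_integrableOn_Ioc]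
      have := hiM_int B hint hQ hQ2
      rwa [intervalIntegrable_iff_integrableOn_Ioc_of_le hQ.le] at this
    · intro x hx hxQ
      exact mul_nonneg (nB x hx hxQ) (nn x hx hxQ)
    · intro x hx hxQ
      rw [hiM_Ioi_pos B hpos hint hx.le hxQ hQ2, ENNReal.ofReal_mul (nB x hx hxQ)]
  have n3 : 0 ≤ ∫ t in (0:ℝ)..Q, B t P * (1 / (1 + Q) - ∫ s in (0:ℝ)..t, B s Q) := by
    rw [intervalIntegral.integral_of_le hQ.le, ← Measure.restrict_congr_set Ioo_ae_eq_Ioc]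
    refine setIntegral_nonneg measurableSet_Ioo fun x hx => ?_
    exact mul_nonneg (nB x hx.1 hx.2) (nn x hx.1 hx.2)
  have i4 : ∫⁻ t in Set.Ioc Q P, ENNReal.ofReal (B t P) * hiM B Q (Set.Ioi t) = 0 := by
    rw [setLIntegral_congr_fun measurableSet_Ioc (g := fun t => 0)
      (fun x hx => by rw [hiM_Ioi_high B hx.1.le hQ, mul_zero])]
    simp
  have n1 : 0 ≤ 1 - 1 / (1 + (P - Q)) := by
    rw [sub_nonneg, div_le_one (by linarith)]; linarith
  rw [i1, i2, i3, i4, add_zero, ← ENNReal.ofReal_add n1 n2, ← ENNReal.ofReal_add (by linarith) n3,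
    hser]
  congr 1
  ring
end

theorem stmt_11
    (b : ℕ → ℕ → ℝ)
    (hrec : ∀ k ℓ : ℕ, b k ℓ = ((k : ℝ) + 1) *
      ((∑ i ∈ Finset.range k, ∑ j ∈ Finset.range (k - i),
          b i (k - 1 - i - j) * b j ℓ / (((i : ℝ) + 1) * ((i : ℝ) + (j : ℝ) + 2)))
        + (∑ i ∈ Finset.range k, (-1 : ℝ) ^ (k - 1 - i) * b i ℓ / ((i : ℝ) + 1))
        - ((-1 : ℝ) ^ (k + 1 + ℓ) * ((k + 1 + ℓ).choose (k + 1) : ℝ) -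
            ((-1 : ℝ) ^ ℓ * ((k + 1 + ℓ).choose (k + 1) : ℝ) +
              (-1 : ℝ) ^ (k + 1 + ℓ) * ((ℓ : ℝ) + 1)) / ((k : ℝ) + 1 + (ℓ : ℝ) + 2))))
    (Bfun : ℝ → ℝ → ℝ)
    (hBfun : ∀ x P : ℝ, Bfun x P = ∑' kl : ℕ × ℕ, b kl.1 kl.2 * x ^ kl.1 * P ^ kl.2)
    (hconv : ∀ x P : ℝ, 0 ≤ x → x < 1 / 2 → x ≤ P → P ≤ 1 / 2 →
      Summable (fun kl : ℕ × ℕ => b kl.1 kl.2 * x ^ kl.1 * P ^ kl.2))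
    (hnonneg : ∀ x P : ℝ, 0 ≤ x → x < 1 / 2 → x ≤ P → P ≤ 1 / 2 → 0 ≤ Bfun x P)
    (hint : ∀ P : ℝ, 0 ≤ P → P ≤ 1 / 2 →
      ∫ x in (0 : ℝ)..P, Bfun x P =
        1 / (P + 1) - Real.sqrt ((1 - 2 * P) / (1 + 2 * P))) :
    ∀ (n : ℕ), 1 ≤ n → ∀ p : Fin n → ℝ, StrictMono p →
      (∀ i, 0 ≤ p i) → (∀ i, p i ≤ 1) →
      ∃ w : Equiv.Perm (Fin n) → ℝ,
        (∀ π, 0 ≤ w π) ∧ (∑ π : Equiv.Perm (Fin n), w π = 1) ∧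
        ∀ i j : Fin n, i < j →
          ∑ π ∈ Finset.univ.filter (fun π : Equiv.Perm (Fin n) => π i < π j), w π =
            min 1 (1 / (p i + p j)) := by
  intro n _ p hp hp0 hp1
  let μ : Fin n → Measure ℝ := fun i =>
    if p i ≤ 1 / 2 then Measure.dirac (p i - 1 / 2) else hiM Bfun (p i - 1 / 2)
  have hlow : ∀ i, p i ≤ 1 / 2 → μ i = Measure.dirac (p i - 1 / 2) := fun i hi => if_pos hi
  have hhigh : ∀ i, 1 / 2 < p i → μ i = hiM Bfun (p i - 1 / 2) := fun i hi => if_neg (not_le.2 hi)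
  have hprob : ∀ i, IsProbabilityMeasure (μ i) := by
    intro i
    rcases le_or_gt (p i) (1 / 2) with h | h
    · rw [hlow i h]; infer_instance
    · rw [hhigh i h]
      exact ⟨hiM_univ Bfun hnonneg hint (by linarith) (by linarith [hp1 i])⟩
  obtain ⟨w, h0, h1, h2⟩ := exists_perm_dist μ
  refine ⟨w, h0, h1, fun i j hij => ?_⟩
  rw [h2 i j hij]
  have hpij := hp hij
  have hi0 := hp0 i
  have hj1 := hp1 j
  have hmeas : MeasurableSet {q : ℝ × ℝ | q.1 ≤ q.2} := measurableSet_le measurable_fst measurable_snd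
  rcases le_or_gt (p i) (1 / 2) with hi | hi
  · have hpre : ((μ i).prod (μ j)).real {q | q.1 ≤ q.2} = (μ j).real (Set.Ici (p i - 1 / 2)) := by
      rw [hlow i hi, Measure.dirac_prod, map_measureReal_apply (by fun_prop) hmeas]
      rfl
    rw [hpre]
    rcases le_or_gt (p j) (1 / 2) with hj | hj
    · rw [hlow j hj, measureReal_def, Measure.dirac_apply' _ measurableSet_Ici,
        Set.indicator_of_mem (by simp only [Set.mem_Ici]; linarith), min_eq_left]
      · simp
      · rw [le_div_iff₀ (by linarith)]; linarith
    · have hP : 0 < p j - 1 / 2 := by linarith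
      have hP2 : p j - 1 / 2 ≤ 1 / 2 := by linarith
      have hIci : (μ j).real (Set.Ici (p i - 1 / 2)) =
          (hiM Bfun (p j - 1 / 2) (Set.Ioi (p i - 1 / 2))).toReal := by
        rw [hhigh j hj, measureReal_def, ← Set.Ioi_union_left, measure_union (by simp)
          (measurableSet_singleton _), hiM_singleton Bfun (by linarith : p i - 1 / 2 < p j - 1 / 2).ne,
          add_zero]
      rw [hIci]
      rcases le_total (p i - 1 / 2) (-(p j - 1 / 2)) with h | h
      · rw [hiM_Ioi_low Bfun hnonneg hint h hP hP2, min_eq_left]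
        · simp
        · rw [le_div_iff₀ (by linarith)]; linarith
      · have e : 1 + (p j - 1 / 2) + (p i - 1 / 2) = p i + p j := by ring
        rw [hiM_Ioi_neg Bfun hnonneg hint h (by linarith) hP hP2, e,
          ENNReal.toReal_ofReal (one_div_nonneg.2 (by linarith)), min_eq_right]
        rw [div_le_one (by linarith)]; linarith
  · have hj : 1 / 2 < p j := hi.trans hpij
    have hQ : 0 < p i - 1 / 2 := by linarith
    have hQP : p i - 1 / 2 < p j - 1 / 2 := by linarith
    have hP2 : p j - 1 / 2 ≤ 1 / 2 := by linarith
    have hser := series_identity b Bfun hrec hBfun hconv hQ hQP hP2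
    have hpr := hiM_prod Bfun hnonneg hint hQ hQP hP2 hser
    have e : 1 + (p j - 1 / 2) + (p i - 1 / 2) = p i + p j := by ring
    rw [e] at hpr
    have hc : ({q : ℝ × ℝ | q.1 ≤ q.2} : Set (ℝ × ℝ)) = {q | q.2 < q.1}ᶜ := by
      ext q; simp
    have hm2 : MeasurableSet {q : ℝ × ℝ | q.2 < q.1} := measurableSet_lt measurable_snd measurable_fst
    have hval : ((μ i).prod (μ j)) {q | q.2 < q.1} = ENNReal.ofReal (1 - 1 / (p i + p j)) := by
      rw [Measure.prod_apply_symm hm2, ← hpr, ← hhigh i hi, ← hhigh j hj]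
      rfl
    have hle : 1 / (p i + p j) ≤ 1 := by rw [div_le_one (by linarith)]; linarith
    rw [hc, probReal_compl_eq_one_sub hm2, measureReal_def, hval,
      ENNReal.toReal_ofReal (by linarith), min_eq_right hle]
    ring
end
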